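/- arXiv:1803.09307 — 3 statements merged into one kernel-verified Lean document; each statement's English description precedes it below -/
import Mathlib

section
/- Let α, α̃, β, β̃ be p.m.p. actions of a countably infinite group Γ with α ≃ α̃ and β ≃ β̃. Then for every finite set S ⊆ Γ, every k ∈ ℕ⁺, and every ε > 0, N_{S,k}(α,β,ε) = N_{S,k}(α̃,β̃,ε); that is, the quantity N_{S,k}(α,β,ε) is determined by the weak equivalence classes of α and β. -/
open MeasureTheory Filter Topology

/-- A probability-measure-preserving (p.m.p.) action of a group `Γ`,
bundled together with the probability space it acts on. -/
structure PMP (Γ : Type) [Group Γ] where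
  /-- the underlying space -/
  X : Type
  /-- the σ-algebra -/
  [mX : MeasurableSpace X]
  /-- the measure -/
  μ : @Measure X mX
  /-- the measure is a probability measure -/
  [prob : IsProbabilityMeasure μ]
  /-- the action map -/
  act : Γ → X → X
  one_act : ∀ x, act 1 x = x
  mul_act : ∀ γ δ x, act (γ * δ) x = act γ (act δ x)
  /-- each group element acts by a measure-preserving (in particular measurable) map -/
  preserves : ∀ γ, MeasurePreserving (act γ) μ μ

attribute [instance] PMP.mX PMP.prob

variable {Γ : Type} [Group Γ]

/-- A p.m.p. action is free if almost every point has trivial stabilizer. -/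
def PMP.Free (a : PMP Γ) : Prop :=
  a.μ {x | ∀ γ : Γ, γ ≠ 1 → a.act γ x ≠ x} = 1

/-- The vector `M^α_{S,k}[f] ∈ [0,1]^{S×k×k}`, defined by
`M^α_{S,k}[f](γ,i,j) = μ {x | f x = i ∧ f (γ • x) = j}`. -/
noncomputable def PMP.M (a : PMP Γ) (S : Finset Γ) (k : ℕ) (f : a.X → Fin k) :
    ↥S × Fin k × Fin k → ℝ :=
  fun q => (a.μ {x | f x = q.2.1 ∧ f (a.act (q.1 : Γ) x) = q.2.2}).toReal

/-- `C(α,S,k)`: the closure of the set of vectors `M^α_{S,k}[f]`, where `f` ranges over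
measurable maps `X → k`, taken in `[0,1]^{S×k×k}`.  (The space `↥S × Fin k × Fin k → ℝ`
carries the sup metric `dist_∞`, since the product distance on a finite product of copies
of `ℝ` is the max of the coordinate distances.) -/
noncomputable def PMP.C (a : PMP Γ) (S : Finset Γ) (k : ℕ) :
    Set (↥S × Fin k × Fin k → ℝ) :=
  closure {v | ∃ f : a.X → Fin k, Measurable f ∧ a.M S k f = v}

/-- The product of two p.m.p. actions:  `γ • (x, y) = (γ • x, γ • y)` on `(X × Y, μ × ν)`. -/
noncomputable def PMP.prod (a b : PMP Γ) : PMP Γ where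
  X := a.X × b.X
  μ := a.μ.prod b.μ
  act γ p := (a.act γ p.1, b.act γ p.2)
  one_act := by intro p; simp [a.one_act, b.one_act]
  mul_act := by intro γ δ p; simp [a.mul_act, b.mul_act]
  preserves γ := (a.preserves γ).prod (b.preserves γ)

/-- `f ∈ Step_{k,N}(X,μ;Y,ν)`: `f = φ ∘ (g,h)` for measurable `g : X → N`, `h : Y → N`
and some `φ : N × N → k`. -/
def IsStep {Γ : Type} [Group Γ] (a b : PMP Γ) (k N : ℕ)
    (f : (a.prod b).X → Fin k) : Prop :=
  ∃ (g : a.X → Fin N) (h : b.X → Fin N) (φ : Fin N × Fin N → Fin k),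
    Measurable g ∧ Measurable h ∧ ∀ p : a.X × b.X, f p = φ (g p.1, h p.2)

/-- The set `{M^{α×β}_{S,k}[f] : f ∈ Step_{k,N}}` is an ε-net in `C(α×β,S,k)`:
every point of `C(α×β,S,k)` is at `dist_∞`-distance `< ε` from a point of this set. -/
def StepNet {Γ : Type} [Group Γ] (a b : PMP Γ) (S : Finset Γ) (k N : ℕ) (ε : ℝ) : Prop :=
  ∀ v ∈ (a.prod b).C S k, ∃ f : (a.prod b).X → Fin k,
    IsStep a b k N f ∧ dist v ((a.prod b).M S k f) < ε

/-- `N_{S,k}(α,β,ε)`: the least `N ∈ ℕ⁺` such that `{M^{α×β}_{S,k}[f] : f ∈ Step_{k,N}}`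
is an ε-net in `C(α×β,S,k)`. -/
noncomputable def NStep {Γ : Type} [Group Γ] (a b : PMP Γ) (S : Finset Γ) (k : ℕ)
    (ε : ℝ) : ℕ :=
  sInf {N : ℕ | 0 < N ∧ StepNet a b S k N ε}

/-- Weak containment: `α ⪯ β` iff `C(α,S,k) ⊆ C(β,S,k)` for all finite `S ⊆ Γ`, `k ∈ ℕ⁺`. -/
def WeakContained {Γ : Type} [Group Γ] (a b : PMP Γ) : Prop :=
  ∀ (S : Finset Γ) (k : ℕ), 0 < k → a.C S k ⊆ b.C S k

/-- Weak equivalence: `α ≃ β` iff `α ⪯ β` and `β ⪯ α`. -/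
def WeakEquiv {Γ : Type} [Group Γ] (a b : PMP Γ) : Prop :=
  WeakContained a b ∧ WeakContained b a

/-- The subsets of a product cut out by finite measurable partitions of the two factors. -/
def gridSets (X Y : Type) [MeasurableSpace X] [MeasurableSpace Y] : Set (Set (X × Y)) :=
  {s | ∃ (A B : Type) (_ : Finite A) (_ : Finite B) (g : X → A) (h : Y → B) (T : Set (A × B)),
    (∀ c, MeasurableSet (g ⁻¹' {c})) ∧ (∀ c, MeasurableSet (h ⁻¹' {c})) ∧
      s = Prod.map g h ⁻¹' T}

theorem measurableSet_preimage_of_finite {X A : Type} [MeasurableSpace X] [Finite A] {g : X → A}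
    (hg : ∀ c, MeasurableSet (g ⁻¹' {c})) (T : Set A) : MeasurableSet (g ⁻¹' T) := by
  rw [← Set.biUnion_preimage_singleton]
  exact MeasurableSet.biUnion T.to_countable fun c _ => hg c

theorem measurableSet_of_mem_gridSets {X Y : Type} [MeasurableSpace X] [MeasurableSpace Y]
    {s : Set (X × Y)} (hs : s ∈ gridSets X Y) : MeasurableSet s := by
  obtain ⟨A, B, _, _, g, h, T, hg, hh, rfl⟩ := hs
  refine measurableSet_preimage_of_finite (fun c => ?_) T
  have : Prod.map g h ⁻¹' {c} = (g ⁻¹' {c.1}) ×ˢ (h ⁻¹' {c.2}) := by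
    ext p; simp [Prod.ext_iff]
  rw [this]
  exact (hg _).prod (hh _)

theorem prod_mem_gridSets {X Y : Type} [MeasurableSpace X] [MeasurableSpace Y]
    {s : Set X} {t : Set Y} (hs : MeasurableSet s) (ht : MeasurableSet t) :
    s ×ˢ t ∈ gridSets X Y := by
  have key : ∀ {Z : Type} [MeasurableSpace Z] {u : Set Z}, MeasurableSet u →
      ∀ c : Prop, MeasurableSet ((fun z => z ∈ u) ⁻¹' {c}) := by
    intro Z _ u hu c
    by_cases hc : c
    · have : (fun z => z ∈ u) ⁻¹' {c} = u := by ext z; simp [hc]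
      rwa [this]
    · have : (fun z => z ∈ u) ⁻¹' {c} = uᶜ := by ext z; simp [hc]
      rw [this]
      exact hu.compl
  refine ⟨Prop, Prop, inferInstance, inferInstance, fun x => x ∈ s, fun y => y ∈ t,
    {c | c.1 ∧ c.2}, key hs, key ht, ?_⟩
  ext p
  simp

theorem isSetAlgebra_gridSets (X Y : Type) [MeasurableSpace X] [MeasurableSpace Y] :
    IsSetAlgebra (gridSets X Y) where
  empty_mem := by simpa using prod_mem_gridSets (X := X) (Y := Y) .empty .empty
  compl_mem := by
    rintro _ ⟨A, B, _, _, g, h, T, hg, hh, rfl⟩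
    exact ⟨A, B, ‹_›, ‹_›, g, h, Tᶜ, hg, hh, rfl⟩
  union_mem := by
    rintro _ _ ⟨A, B, _, _, g, h, T, hg, hh, rfl⟩ ⟨A', B', _, _, g', h', T', hg', hh', rfl⟩
    refine ⟨A × A', B × B', inferInstance, inferInstance, fun x => (g x, g' x),
      fun y => (h y, h' y), {c | (c.1.1, c.2.1) ∈ T ∨ (c.1.2, c.2.2) ∈ T'}, fun c => ?_,
      fun c => ?_, rfl⟩
    · convert (hg c.1).inter (hg' c.2) using 1
      ext x; simp [Prod.ext_iff]
    · convert (hh c.1).inter (hh' c.2) using 1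
      ext x; simp [Prod.ext_iff]

theorem generateFrom_gridSets (X Y : Type) [MeasurableSpace X] [MeasurableSpace Y] :
    (inferInstance : MeasurableSpace (X × Y)) = MeasurableSpace.generateFrom (gridSets X Y) := by
  apply le_antisymm
  · refine le_trans (generateFrom_prod (α := X) (β := Y)).ge ?_
    refine MeasurableSpace.generateFrom_mono ?_
    rintro _ ⟨s, hs, t, ht, rfl⟩
    exact prod_mem_gridSets hs ht
  · exact MeasurableSpace.generateFrom_le fun s hs => measurableSet_of_mem_gridSets hs

/-- Measurable maps from a product to a finite set are approximated in measure by maps that factor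
through finite measurable partitions of the two factors. -/
theorem exists_grid_approx {X Y : Type} [MeasurableSpace X] [MeasurableSpace Y]
    (μ : Measure (X × Y)) [IsFiniteMeasure μ] {k : ℕ} (hk : 0 < k) {f : X × Y → Fin k}
    (hf : Measurable f) {δ : ℝ} (hδ : 0 < δ) :
    ∃ (A B : Type) (_ : Finite A) (_ : Finite B) (g : X → A) (h : Y → B) (ψ : A × B → Fin k),
      (∀ c, MeasurableSet (g ⁻¹' {c})) ∧ (∀ c, MeasurableSet (h ⁻¹' {c})) ∧
        μ.real {p | f p ≠ ψ (g p.1, h p.2)} ≤ δ := by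
  classical
  have hk' : (0 : ℝ) < k := by exact_mod_cast hk
  have dense := Measure.MeasureDense.of_generateFrom_isSetAlgebra_finite (μ := μ)
    (isSetAlgebra_gridSets X Y) (generateFrom_gridSets X Y)
  have approx : ∀ i : Fin k, ∃ t ∈ gridSets X Y,
      μ (symmDiff (f ⁻¹' {i}) t) < ENNReal.ofReal (δ / k) := fun i =>
    dense.approx _ (hf (measurableSet_singleton i)) (measure_ne_top _ _) _ (div_pos hδ hk')
  choose t ht hμt using approx
  choose A B _ _ g h T hg hh hT using ht
  let ψ : (∀ i, A i) × (∀ i, B i) → Fin k := fun c =>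
    if hc : ∃ i, (c.1 i, c.2 i) ∈ T i then hc.choose else ⟨0, hk⟩
  refine ⟨∀ i, A i, ∀ i, B i, inferInstance, inferInstance, fun x i => g i x, fun y i => h i y,
    ψ, fun c => ?_, fun c => ?_, ?_⟩
  · convert MeasurableSet.iInter fun i => hg i (c i) using 1
    ext x; simp [funext_iff]
  · convert MeasurableSet.iInter fun i => hh i (c i) using 1
    ext x; simp [funext_iff]
  · have hsub : {p : X × Y | f p ≠ ψ (fun i => g i p.1, fun i => h i p.2)} ⊆
        ⋃ i, symmDiff (f ⁻¹' {i}) (t i) := by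
      intro p hp
      by_contra hcon
      have hiff : ∀ i, f p = i ↔ (g i p.1, h i p.2) ∈ T i := by
        intro i
        have hi : p ∉ symmDiff (f ⁻¹' {i}) (t i) := fun hi => hcon (Set.mem_iUnion.2 ⟨i, hi⟩)
        have hpt : p ∈ t i ↔ (g i p.1, h i p.2) ∈ T i := by rw [hT i]; rfl
        rw [Set.mem_symmDiff, hpt] at hi
        simp only [Set.mem_preimage, Set.mem_singleton_iff] at hi
        tauto
      have hex : ∃ i, (g i p.1, h i p.2) ∈ T i := ⟨f p, (hiff _).1 rfl⟩
      apply hp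
      have hψ : ψ (fun i => g i p.1, fun i => h i p.2) = hex.choose := dif_pos hex
      rw [hψ]
      exact (hiff _).2 hex.choose_spec
    calc μ.real {p : X × Y | f p ≠ ψ (fun i => g i p.1, fun i => h i p.2)}
        ≤ μ.real (⋃ i, symmDiff (f ⁻¹' {i}) (t i)) := measureReal_mono hsub
      _ ≤ ∑ i, μ.real (symmDiff (f ⁻¹' {i}) (t i)) := measureReal_iUnion_fintype_le _
      _ ≤ ∑ _i : Fin k, δ / k := by
          refine Finset.sum_le_sum fun i _ => ?_
          exact ENNReal.toReal_le_of_le_ofReal (div_pos hδ hk').le (hμt i).le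
      _ = δ := by simp; field_simp

theorem isStep_of_finite (a b : PMP Γ) {k : ℕ} (hk : 0 < k) {A B : Type} [Finite A] [Finite B]
    {g : a.X → A} {h : b.X → B} (ψ : A × B → Fin k) (hg : ∀ c, MeasurableSet (g ⁻¹' {c}))
    (hh : ∀ c, MeasurableSet (h ⁻¹' {c})) :
    ∃ N, 0 < N ∧ IsStep a b k N (fun p : a.X × b.X => ψ (g p.1, h p.2)) := by
  obtain ⟨n, ⟨e⟩⟩ := Finite.exists_equiv_fin A
  obtain ⟨m, ⟨e'⟩⟩ := Finite.exists_equiv_fin B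
  let N := max n m + 1
  let u : A → Fin N := fun c => Fin.castLE (by omega) (e c)
  let v : B → Fin N := fun c => Fin.castLE (by omega) (e' c)
  have hu : Function.Injective u := (Fin.castLE_injective _).comp e.injective
  have hv : Function.Injective v := (Fin.castLE_injective _).comp e'.injective
  refine ⟨N, by omega, u ∘ g, v ∘ h, Function.extend (Prod.map u v) ψ fun _ => ⟨0, hk⟩, ?_, ?_,
    fun p => ((hu.prodMap hv).extend_apply ψ _ (g p.1, h p.2)).symm⟩
  · refine measurable_to_countable' fun c => ?_
    rw [Set.preimage_comp]
    exact measurableSet_preimage_of_finite hg _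
  · refine measurable_to_countable' fun c => ?_
    rw [Set.preimage_comp]
    exact measurableSet_preimage_of_finite hh _

theorem PMP.dist_M_le (a : PMP Γ) (S : Finset Γ) {k : ℕ} {f f' : a.X → Fin k}
    (hf : Measurable f) (hf' : Measurable f') :
    dist (a.M S k f) (a.M S k f') ≤ 2 * a.μ.real {x | f x ≠ f' x} := by
  refine (dist_pi_le_iff (by positivity)).2 fun q => ?_
  have hact := a.preserves (q.1 : Γ)
  have hD : MeasurableSet {x | f x ≠ f' x} := (measurableSet_eq_fun hf hf').compl
  have meas : ∀ {f : a.X → Fin k}, Measurable f →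
      MeasurableSet {x | f x = q.2.1 ∧ f (a.act (q.1 : Γ) x) = q.2.2} := fun hf =>
    (hf (measurableSet_singleton _)).inter
      ((hf.comp hact.measurable) (measurableSet_singleton _))
  have key : a.μ.real (symmDiff {x | f x = q.2.1 ∧ f (a.act (q.1 : Γ) x) = q.2.2}
      {x | f' x = q.2.1 ∧ f' (a.act (q.1 : Γ) x) = q.2.2}) ≤
      2 * a.μ.real {x | f x ≠ f' x} := by
    have hsub : symmDiff {x | f x = q.2.1 ∧ f (a.act (q.1 : Γ) x) = q.2.2}
        {x | f' x = q.2.1 ∧ f' (a.act (q.1 : Γ) x) = q.2.2} ⊆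
        {x | f x ≠ f' x} ∪ a.act (q.1 : Γ) ⁻¹' {x | f x ≠ f' x} := by
      intro x hx
      by_contra hcon
      simp only [Set.mem_union, Set.mem_preimage, Set.mem_ofPred_eq, not_or, not_not] at hcon
      simp only [Set.mem_symmDiff, Set.mem_ofPred_eq, hcon.1, hcon.2] at hx
      tauto
    refine (measureReal_mono hsub).trans ((measureReal_union_le _ _).trans ?_)
    rw [hact.measureReal_preimage hD.nullMeasurableSet, two_mul]
  rw [Real.dist_eq]
  exact (abs_measureReal_sub_le_measureReal_symmDiff (meas hf).nullMeasurableSet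
    (meas hf').nullMeasurableSet).trans key

/-- The vector `M^{α×β}_{S,k}[φ ∘ (g, h)]` in terms of the vectors `M^α_{S,N}[g]` and
`M^β_{S,N}[h]`. -/
noncomputable def stepVector {Λ : Type} (S : Finset Λ) {k N : ℕ} (φ : Fin N × Fin N → Fin k)
    (u v : ↥S × Fin N × Fin N → ℝ) : ↥S × Fin k × Fin k → ℝ := fun q =>
  ∑ t : (Fin N × Fin N) × (Fin N × Fin N) with
    φ (t.1.1, t.2.1) = q.2.1 ∧ φ (t.1.2, t.2.2) = q.2.2, u (q.1, t.1) * v (q.1, t.2)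

theorem continuous_stepVector {Λ : Type} (S : Finset Λ) {k N : ℕ} (φ : Fin N × Fin N → Fin k) :
    Continuous fun w : (↥S × Fin N × Fin N → ℝ) × (↥S × Fin N × Fin N → ℝ) =>
      stepVector S φ w.1 w.2 := by
  unfold stepVector
  fun_prop

theorem M_prod_step (a b : PMP Γ) (S : Finset Γ) {k N : ℕ} (φ : Fin N × Fin N → Fin k)
    {g : a.X → Fin N} {h : b.X → Fin N} (hg : Measurable g) (hh : Measurable h) :
    (a.prod b).M S k (fun p : a.X × b.X => φ (g p.1, h p.2)) =
      stepVector S φ (a.M S N g) (b.M S N h) := by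
  funext q
  let E : Fin N × Fin N → Set a.X := fun c => {x | g x = c.1 ∧ g (a.act (q.1 : Γ) x) = c.2}
  let F : Fin N × Fin N → Set b.X := fun c => {y | h y = c.1 ∧ h (b.act (q.1 : Γ) y) = c.2}
  have hE : ∀ c, MeasurableSet (E c) := fun c => (hg (measurableSet_singleton _)).inter
    ((hg.comp (a.preserves (q.1 : Γ)).measurable) (measurableSet_singleton _))
  have hF : ∀ c, MeasurableSet (F c) := fun c => (hh (measurableSet_singleton _)).inter
    ((hh.comp (b.preserves (q.1 : Γ)).measurable) (measurableSet_singleton _))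
  have hset : {p : a.X × b.X | φ (g p.1, h p.2) = q.2.1 ∧
      φ (g (a.act (q.1 : Γ) p.1), h (b.act (q.1 : Γ) p.2)) = q.2.2} =
      ⋃ t ∈ Finset.univ.filter fun t : (Fin N × Fin N) × (Fin N × Fin N) =>
        φ (t.1.1, t.2.1) = q.2.1 ∧ φ (t.1.2, t.2.2) = q.2.2, E t.1 ×ˢ F t.2 := by
    ext p
    simp only [Set.mem_ofPred_eq, Finset.mem_filter, Finset.mem_univ, true_and, Set.mem_iUnion,
      Set.mem_prod, exists_prop, E, F]
    constructor
    · intro hp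
      exact ⟨((g p.1, g (a.act (q.1 : Γ) p.1)), (h p.2, h (b.act (q.1 : Γ) p.2))), hp,
        ⟨rfl, rfl⟩, ⟨rfl, rfl⟩⟩
    · rintro ⟨t, ht, ⟨h1, h2⟩, h3, h4⟩
      rw [h1, h2, h3, h4]
      exact ht
  change (a.μ.prod b.μ).real {p : a.X × b.X | φ (g p.1, h p.2) = q.2.1 ∧
      φ (g (a.act (q.1 : Γ) p.1), h (b.act (q.1 : Γ) p.2)) = q.2.2} = _
  rw [hset, measureReal_biUnion_finset]
  · refine Finset.sum_congr rfl fun t _ => ?_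
    rw [measureReal_prod_prod]
    rfl
  · rintro s - t - hst
    refine Set.disjoint_left.2 ?_
    rintro p ⟨⟨h1, h2⟩, h3, h4⟩ ⟨⟨h5, h6⟩, h7, h8⟩
    exact hst (Prod.ext (Prod.ext (h1.symm.trans h5) (h2.symm.trans h6))
      (Prod.ext (h3.symm.trans h7) (h4.symm.trans h8)))
  · exact fun t _ => (hE _).prod (hF _)

/-- The set of vectors `M^{α×β}_{S,k}[f]` of the `N`-step functions `f`. -/
def stepVectors (a b : PMP Γ) (S : Finset Γ) (k N : ℕ) : Set (↥S × Fin k × Fin k → ℝ) :=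
  {v | ∃ f : (a.prod b).X → Fin k, IsStep a b k N f ∧ (a.prod b).M S k f = v}

theorem stepVectors_subset_closure {a a' b b' : PMP Γ} (ha : WeakContained a a')
    (hb : WeakContained b b') (S : Finset Γ) (k : ℕ) {N : ℕ} (hN : 0 < N) :
    stepVectors a b S k N ⊆ closure (stepVectors a' b' S k N) := by
  rintro _ ⟨f, ⟨g, h, φ, hg, hh, hf⟩, rfl⟩
  obtain rfl : f = fun p : a.X × b.X => φ (g p.1, h p.2) := funext hf
  rw [M_prod_step a b S φ hg hh]
  have hmem : (a.M S N g, b.M S N h) ∈ a'.C S N ×ˢ b'.C S N :=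
    ⟨ha S N hN (subset_closure ⟨g, hg, rfl⟩), hb S N hN (subset_closure ⟨h, hh, rfl⟩)⟩
  unfold PMP.C at hmem
  rw [← closure_prod_eq] at hmem
  refine map_mem_closure (f := fun w => stepVector S φ w.1 w.2) (continuous_stepVector S φ) hmem ?_
  rintro ⟨_, _⟩ ⟨⟨g', hg', rfl⟩, ⟨h', hh', rfl⟩⟩
  exact ⟨_, ⟨g', h', φ, hg', hh', fun _ => rfl⟩, M_prod_step a' b' S φ hg' hh'⟩

theorem IsStep.measurable {a b : PMP Γ} {k N : ℕ} {f : (a.prod b).X → Fin k}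
    (hf : IsStep a b k N f) : Measurable f := by
  obtain ⟨g, h, φ, hg, hh, hf⟩ := hf
  obtain rfl : f = fun p : a.X × b.X => φ (g p.1, h p.2) := funext hf
  exact (measurable_of_countable φ).comp
    ((hg.comp measurable_fst).prodMk (hh.comp measurable_snd))

theorem C_prod_eq_closure_iUnion_stepVectors (a b : PMP Γ) (S : Finset Γ) {k : ℕ} (hk : 0 < k) :
    (a.prod b).C S k = closure (⋃ N ∈ Set.Ioi 0, stepVectors a b S k N) := by
  apply subset_antisymm
  · refine closure_minimal ?_ isClosed_closure
    rintro _ ⟨f, hf, rfl⟩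
    refine Metric.mem_closure_iff.2 fun ε hε => ?_
    obtain ⟨A, B, _, _, g, h, ψ, hg, hh, hδ⟩ :=
      exists_grid_approx (a.μ.prod b.μ) hk (f := f) hf (δ := ε / 4) (by positivity)
    obtain ⟨N, hN, hstep⟩ := isStep_of_finite a b hk ψ hg hh
    refine ⟨_, Set.mem_biUnion (Set.mem_Ioi.2 hN) ⟨_, hstep, rfl⟩, ?_⟩
    have hle : dist ((a.prod b).M S k f) _ ≤ _ := (a.prod b).dist_M_le S hf hstep.measurable
    have hδ' : (a.prod b).μ.real
        {p | f p ≠ (fun p : a.X × b.X => ψ (g p.1, h p.2)) p} ≤ ε / 4 := hδ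
    linarith
  · refine closure_mono (Set.iUnion₂_subset fun N _ => ?_)
    rintro _ ⟨f, hf, rfl⟩
    exact ⟨f, hf.measurable, rfl⟩

theorem C_prod_subset {a a' b b' : PMP Γ} (ha : WeakContained a a') (hb : WeakContained b b')
    (S : Finset Γ) {k : ℕ} (hk : 0 < k) : (a.prod b).C S k ⊆ (a'.prod b').C S k := by
  rw [C_prod_eq_closure_iUnion_stepVectors a b S hk, C_prod_eq_closure_iUnion_stepVectors a' b' S hk]
  refine closure_minimal (Set.iUnion₂_subset fun N hN => ?_) isClosed_closure
  exact (stepVectors_subset_closure ha hb S k hN).trans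
    (closure_mono (Set.subset_biUnion_of_mem (u := fun N => stepVectors a' b' S k N) hN))

theorem StepNet.of_weakEquiv {a a' b b' : PMP Γ} (ha : WeakEquiv a a') (hb : WeakEquiv b b')
    {S : Finset Γ} {k N : ℕ} (hk : 0 < k) (hN : 0 < N) {ε : ℝ} (h : StepNet a b S k N ε) :
    StepNet a' b' S k N ε := by
  intro v hv
  obtain ⟨f, hf, hd⟩ := h v (C_prod_subset ha.2 hb.2 S hk hv)
  obtain ⟨_, ⟨f', hf', rfl⟩, hd'⟩ := Metric.mem_closure_iff.1
    (stepVectors_subset_closure ha.1 hb.1 S k hN ⟨f, hf, rfl⟩) _ (sub_pos.2 hd)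
  refine ⟨f', hf', (dist_triangle _ ((a.prod b).M S k f) _).trans_lt ?_⟩
  linarith

/-- Lemma-Definition 4.1 ("furthermore" part): `N_{S,k}(α,β,ε)` only depends on the weak
equivalence classes of `α` and `β`: if `α ≃ α̃` and `β ≃ β̃`, then
`N_{S,k}(α,β,ε) = N_{S,k}(α̃,β̃,ε)`. -/
theorem NStep_weakEquiv_invariant {Γ : Type} [Group Γ] [Countable Γ] [Infinite Γ]
    (a a' b b' : PMP Γ) (ha : WeakEquiv a a') (hb : WeakEquiv b b')
    (S : Finset Γ) (k : ℕ) (hk : 0 < k) (ε : ℝ) (hε : 0 < ε) :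
    NStep a b S k ε = NStep a' b' S k ε := by
  unfold NStep
  congr 1
  ext N
  exact and_congr_right fun hN =>
    ⟨StepNet.of_weakEquiv ha hb hk hN, StepNet.of_weakEquiv (And.symm ha) (And.symm hb) hk hN⟩
end

section
/- Let α_i, β_i (i ∈ ℕ), α, β be p.m.p. actions of a countably infinite group Γ such that for every finite S' ⊆ Γ and every k' ∈ ℕ⁺, dist_H(C(α_i,S',k'), C(α,S',k')) → 0 and dist_H(C(β_i,S',k'), C(β,S',k')) → 0 as i → ∞. Then (with no further assumptions) for every finite S ⊆ Γ, every k ∈ ℕ⁺, and every ε > 0, one has C(α×β,S,k) ⊆ Ball_ε(C(α_i×β_i,S,k)) for all sufficiently large i, where Ball_ε(C) := {u ∈ [0,1]^{S×k×k} : dist_∞(u,C) < ε}. -/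
open MeasureTheory Filter Topology

variable {Γ : Type} [Group Γ]

open scoped symmDiff

section Approximation

variable {X Y : Type*} [MeasurableSpace X] [MeasurableSpace Y]

/-- Subsets of `X × Y` which are finite unions of cells of the product of a finite measurable
partition of `X` and a finite measurable partition of `Y`. -/
def finiteRectangleUnions (X Y : Type*) [MeasurableSpace X] [MeasurableSpace Y] :
    Set (Set (X × Y)) :=
  {E | ∃ (m n : ℕ) (g : X → Fin m) (h : Y → Fin n) (P : Set (Fin m × Fin n)),
    Measurable g ∧ Measurable h ∧ E = {z | (g z.1, h z.2) ∈ P}}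

theorem mem_finiteRectangleUnions_of_finite {ι κ : Type*} [Finite ι] [Finite κ]
    [MeasurableSpace ι] [MeasurableSpace κ] [DiscreteMeasurableSpace ι]
    [DiscreteMeasurableSpace κ] {g : X → ι} {h : Y → κ} (hg : Measurable g) (hh : Measurable h)
    (P : Set (ι × κ)) : {z : X × Y | (g z.1, h z.2) ∈ P} ∈ finiteRectangleUnions X Y := by
  obtain ⟨m, ⟨e⟩⟩ := Finite.exists_equiv_fin ι
  obtain ⟨n, ⟨e'⟩⟩ := Finite.exists_equiv_fin κ
  refine ⟨m, n, e ∘ g, e' ∘ h, {p | (e.symm p.1, e'.symm p.2) ∈ P},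
    (Measurable.of_discrete).comp hg, (Measurable.of_discrete).comp hh, ?_⟩
  ext z
  simp

theorem isSetAlgebra_finiteRectangleUnions : IsSetAlgebra (finiteRectangleUnions X Y) where
  empty_mem := by
    simpa using mem_finiteRectangleUnions_of_finite (X := X) (Y := Y)
      (g := fun _ => ()) (h := fun _ => ()) measurable_const measurable_const ∅
  compl_mem := by
    rintro _ ⟨m, n, g, h, P, hg, hh, rfl⟩
    exact ⟨m, n, g, h, Pᶜ, hg, hh, rfl⟩
  union_mem := by
    rintro _ _ ⟨m, n, g, h, P, hg, hh, rfl⟩ ⟨m', n', g', h', P', hg', hh', rfl⟩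
    exact mem_finiteRectangleUnions_of_finite (hg.prodMk hg') (hh.prodMk hh')
      {p | (p.1.1, p.2.1) ∈ P ∨ (p.1.2, p.2.2) ∈ P'}

theorem measurableSet_of_mem_finiteRectangleUnions {E : Set (X × Y)}
    (hE : E ∈ finiteRectangleUnions X Y) : MeasurableSet E := by
  obtain ⟨m, n, g, h, P, hg, hh, rfl⟩ := hE
  exact ((hg.comp measurable_fst).prodMk (hh.comp measurable_snd)) (MeasurableSet.of_discrete)

theorem generateFrom_finiteRectangleUnions :
    (inferInstance : MeasurableSpace (X × Y)) =
      MeasurableSpace.generateFrom (finiteRectangleUnions X Y) := by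
  classical
  apply le_antisymm
  · rw [← generateFrom_prod]
    refine MeasurableSpace.generateFrom_mono ?_
    rintro _ ⟨s, hs, t, ht, rfl⟩
    have hs' : Measurable fun x => decide (x ∈ s) := measurable_to_bool (by
      simpa [Set.preimage] using hs)
    have ht' : Measurable fun y => decide (y ∈ t) := measurable_to_bool (by
      simpa [Set.preimage] using ht)
    convert mem_finiteRectangleUnions_of_finite hs' ht' {(true, true)} using 1
    ext z
    simp
  · exact MeasurableSpace.generateFrom_le fun _ => measurableSet_of_mem_finiteRectangleUnions

/-- A measurable map from a product space to a finite set agrees, off a set of small measure, with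
a map depending only on the cells of finite measurable partitions of the two factors. -/
theorem exists_partition_measureReal_ne_lt (ρ : Measure (X × Y)) [IsFiniteMeasure ρ] {k : ℕ}
    (hk : 0 < k) {f : X × Y → Fin k} (hf : Measurable f) {ε : ℝ} (hε : 0 < ε) :
    ∃ (m n : ℕ) (g : X → Fin m) (h : Y → Fin n) (F : Fin m × Fin n → Fin k),
      Measurable g ∧ Measurable h ∧ ρ.real {z | f z ≠ F (g z.1, h z.2)} < ε := by
  classical
  have hdense := Measure.MeasureDense.of_generateFrom_isSetAlgebra_finite (μ := ρ)
    isSetAlgebra_finiteRectangleUnions generateFrom_finiteRectangleUnions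
  have happrox : ∀ c : Fin k, ∃ E ∈ finiteRectangleUnions X Y,
      ρ.real ((f ⁻¹' {c}) ∆ E) < ε / k := by
    intro c
    obtain ⟨E, hE, hlt⟩ := hdense.approx (f ⁻¹' {c}) (hf (measurableSet_singleton c))
      (measure_ne_top _ _) (ε / k) (by positivity)
    refine ⟨E, hE, ?_⟩
    rw [Measure.real]
    exact (ENNReal.lt_ofReal_iff_toReal_lt (measure_ne_top _ _)).1 hlt
  choose E hE hlt using happrox
  choose m n g h P hg hh hP using hE
  obtain ⟨M, ⟨e⟩⟩ := Finite.exists_equiv_fin (∀ c, Fin (m c))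
  obtain ⟨N, ⟨e'⟩⟩ := Finite.exists_equiv_fin (∀ c, Fin (n c))
  let F : Fin M × Fin N → Fin k := fun p =>
    if hc : ∃ c, (e.symm p.1 c, e'.symm p.2 c) ∈ P c then hc.choose else ⟨0, hk⟩
  refine ⟨M, N, fun x => e fun c => g c x, fun y => e' fun c => h c y, F,
    (Measurable.of_discrete (f := e)).comp (measurable_pi_lambda _ hg),
    (Measurable.of_discrete (f := e')).comp (measurable_pi_lambda _ hh), ?_⟩
  have hsub : {z : X × Y | f z ≠ F (e fun c => g c z.1, e' fun c => h c z.2)} ⊆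
      ⋃ c, (f ⁻¹' {c}) ∆ E c := by
    intro z hz
    by_contra hcon
    have key : ∀ c, f z = c ↔ (g c z.1, h c z.2) ∈ P c := by
      intro c
      have hc : z ∉ (f ⁻¹' {c}) ∆ E c := fun hmem => hcon (Set.mem_iUnion.2 ⟨c, hmem⟩)
      rw [hP c, Set.mem_symmDiff] at hc
      simp only [Set.mem_preimage, Set.mem_singleton_iff, Set.mem_ofPred_eq] at hc
      tauto
    refine hz ?_
    have hex : ∃ c, (g c z.1, h c z.2) ∈ P c := ⟨f z, (key _).1 rfl⟩
    simp only [F, Equiv.symm_apply_apply]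
    rw [dif_pos hex]
    exact (key _).2 hex.choose_spec
  have : Nonempty (Fin k) := ⟨⟨0, hk⟩⟩
  calc ρ.real {z : X × Y | f z ≠ F (e fun c => g c z.1, e' fun c => h c z.2)}
      ≤ ρ.real (⋃ c, (f ⁻¹' {c}) ∆ E c) := measureReal_mono hsub
    _ ≤ ∑ c, ρ.real ((f ⁻¹' {c}) ∆ E c) := measureReal_iUnion_fintype_le _
    _ < ∑ _c : Fin k, ε / k := Finset.sum_lt_sum_of_nonempty Finset.univ_nonempty fun c _ => hlt c
    _ = ε := by
      have : (k : ℝ) ≠ 0 := by positivity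
      simp
      field_simp

end Approximation

namespace PMP

theorem M_mem_Icc (a : PMP Γ) (S : Finset Γ) (k : ℕ) (f : a.X → Fin k) :
    a.M S k f ∈ Set.Icc (0 : ↥S × Fin k × Fin k → ℝ) 1 :=
  ⟨fun _ => measureReal_nonneg, fun _ => measureReal_le_one⟩

theorem C_subset_Icc (a : PMP Γ) (S : Finset Γ) (k : ℕ) : a.C S k ⊆ Set.Icc 0 1 := by
  refine closure_minimal ?_ isClosed_Icc
  rintro _ ⟨f, -, rfl⟩
  exact a.M_mem_Icc S k f

theorem isCompact_C (a : PMP Γ) (S : Finset Γ) (k : ℕ) : IsCompact (a.C S k) :=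
  isCompact_Icc.of_isClosed_subset isClosed_closure (a.C_subset_Icc S k)

theorem M_mem_C (a : PMP Γ) (S : Finset Γ) {k : ℕ} {f : a.X → Fin k} (hf : Measurable f) :
    a.M S k f ∈ a.C S k :=
  subset_closure ⟨f, hf, rfl⟩

theorem C_nonempty (a : PMP Γ) (S : Finset Γ) {k : ℕ} (hk : 0 < k) : (a.C S k).Nonempty :=
  ⟨_, a.M_mem_C S (f := fun _ => ⟨0, hk⟩) measurable_const⟩

theorem exists_dist_M_lt_of_mem_C (a : PMP Γ) {S : Finset Γ} {k : ℕ}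
    {v : ↥S × Fin k × Fin k → ℝ} (hv : v ∈ a.C S k) {ε : ℝ} (hε : 0 < ε) :
    ∃ f : a.X → Fin k, Measurable f ∧ dist v (a.M S k f) < ε := by
  obtain ⟨_, ⟨f, hf, rfl⟩, h⟩ := Metric.mem_closure_iff.1 hv ε hε
  exact ⟨f, hf, h⟩

theorem eventually_exists_dist_M_lt {A : ℕ → PMP Γ} {a : PMP Γ} {S : Finset Γ} {k : ℕ}
    (hA : Tendsto (fun i => Metric.hausdorffDist ((A i).C S k) (a.C S k)) atTop (𝓝 0))
    {f : a.X → Fin k} (hf : Measurable f) {ε : ℝ} (hε : 0 < ε) :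
    ∀ᶠ i in atTop, ∃ f' : (A i).X → Fin k,
      Measurable f' ∧ dist ((A i).M S k f') (a.M S k f) < ε := by
  have hk : 0 < k := by
    have := nonempty_of_isProbabilityMeasure a.μ
    exact (f (Classical.arbitrary _)).pos
  filter_upwards [hA.eventually_lt_const (half_pos hε)] with i hi
  rw [Metric.hausdorffDist_comm] at hi
  obtain ⟨u, hu, hlt⟩ := Metric.exists_dist_lt_of_hausdorffDist_lt (a.M_mem_C S hf) hi
    (Metric.hausdorffEDist_ne_top_of_nonempty_of_bounded (a.C_nonempty S hk)
      ((A i).C_nonempty S hk) (a.isCompact_C S k).isBounded ((A i).isCompact_C S k).isBounded)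
  obtain ⟨f', hf', hlt'⟩ := (A i).exists_dist_M_lt_of_mem_C hu (half_pos hε)
  refine ⟨f', hf', ?_⟩
  rw [dist_comm]
  linarith [dist_triangle (a.M S k f) u ((A i).M S k f')]

theorem dist_M_le_s10 (a : PMP Γ) (S : Finset Γ) {k : ℕ} {f f' : a.X → Fin k}
    (hf : Measurable f) (hf' : Measurable f') :
    dist (a.M S k f) (a.M S k f') ≤ 2 * a.μ.real {x | f x ≠ f' x} := by
  refine (dist_pi_le_iff (by positivity)).2 fun q => ?_
  obtain ⟨γ, i, j⟩ := q
  have hmeas : ∀ {u : a.X → Fin k}, Measurable u →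
      MeasurableSet {x | u x = i ∧ u (a.act (γ : Γ) x) = j} := fun hu =>
    (hu (measurableSet_singleton i)).inter
      ((hu.comp (a.preserves γ).measurable) (measurableSet_singleton j))
  have hne : MeasurableSet {x | f x ≠ f' x} := (measurableSet_eq_fun hf hf').compl
  have hsub : {x | f x = i ∧ f (a.act (γ : Γ) x) = j} ∆ {x | f' x = i ∧ f' (a.act (γ : Γ) x) = j}
      ⊆ {x | f x ≠ f' x} ∪ a.act γ ⁻¹' {x | f x ≠ f' x} := by
    intro x hx
    by_contra hcon
    simp only [Set.mem_union, Set.mem_preimage, Set.mem_ofPred_eq, not_or, not_not] at hcon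
    simp only [Set.mem_symmDiff, Set.mem_ofPred_eq, hcon.1, hcon.2] at hx
    tauto
  rw [Real.dist_eq]
  calc |a.μ.real {x | f x = i ∧ f (a.act (γ : Γ) x) = j} -
        a.μ.real {x | f' x = i ∧ f' (a.act (γ : Γ) x) = j}|
      ≤ a.μ.real ({x | f x = i ∧ f (a.act (γ : Γ) x) = j} ∆
          {x | f' x = i ∧ f' (a.act (γ : Γ) x) = j}) :=
        abs_measureReal_sub_le_measureReal_symmDiff (hmeas hf).nullMeasurableSet
          (hmeas hf').nullMeasurableSet
    _ ≤ a.μ.real ({x | f x ≠ f' x} ∪ a.act γ ⁻¹' {x | f x ≠ f' x}) := measureReal_mono hsub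
    _ ≤ a.μ.real {x | f x ≠ f' x} + a.μ.real (a.act γ ⁻¹' {x | f x ≠ f' x}) :=
        measureReal_union_le _ _
    _ = 2 * a.μ.real {x | f x ≠ f' x} := by
        rw [(a.preserves γ).measureReal_preimage hne.nullMeasurableSet]
        ring

/-- The vector of the map `(x, y) ↦ F (g x, h y)` for a product action, as a function of the vectors
of `g` and `h`. -/
noncomputable def combine {ι : Type*} {m n k : ℕ} (F : Fin m × Fin n → Fin k)
    (p : (ι × Fin m × Fin m → ℝ) × (ι × Fin n × Fin n → ℝ)) : ι × Fin k × Fin k → ℝ :=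
  fun q => ∑ t : (Fin m × Fin m) × (Fin n × Fin n) with
    F (t.1.1, t.2.1) = q.2.1 ∧ F (t.1.2, t.2.2) = q.2.2, p.1 (q.1, t.1) * p.2 (q.1, t.2)

theorem continuous_combine {ι : Type*} {m n k : ℕ} (F : Fin m × Fin n → Fin k) :
    Continuous (combine (ι := ι) F) := by
  unfold combine
  fun_prop

theorem M_prod_comp (a b : PMP Γ) (S : Finset Γ) {m n k : ℕ} {g : a.X → Fin m}
    {h : b.X → Fin n} (hg : Measurable g) (hh : Measurable h) (F : Fin m × Fin n → Fin k) :
    (a.prod b).M S k (fun z => F (g z.1, h z.2)) = combine F (a.M S m g, b.M S n h) := by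
  funext q
  obtain ⟨γ, i, j⟩ := q
  let T : a.X × b.X → (Fin m × Fin m) × (Fin n × Fin n) := fun z =>
    ((g z.1, g (a.act γ z.1)), (h z.2, h (b.act γ z.2)))
  have hT : Measurable T := by
    have h1 := hg.comp (a.preserves γ).measurable
    have h2 := hh.comp (b.preserves γ).measurable
    exact ((hg.prodMk h1).comp measurable_fst).prodMk ((hh.prodMk h2).comp measurable_snd)
  have hsum := sum_measureReal_preimage_singleton (μ := a.μ.prod b.μ)
    ({t | F (t.1.1, t.2.1) = i ∧ F (t.1.2, t.2.2) = j} :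
      Finset ((Fin m × Fin m) × (Fin n × Fin n))) (f := T)
    fun t _ => hT (measurableSet_singleton t)
  have hpre : (T ⁻¹' ((({t | F (t.1.1, t.2.1) = i ∧ F (t.1.2, t.2.2) = j} :
      Finset ((Fin m × Fin m) × (Fin n × Fin n))) : Set _))) =
      {z | F (g z.1, h z.2) = i ∧ F (g (a.act γ z.1), h (b.act γ z.2)) = j} := by
    ext z
    simp [T]
  rw [hpre] at hsum
  refine hsum.symm.trans (Finset.sum_congr rfl fun t _ => ?_)
  have hrect : T ⁻¹' {t} = {x | g x = t.1.1 ∧ g (a.act γ x) = t.1.2} ×ˢ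
      {y | h y = t.2.1 ∧ h (b.act γ y) = t.2.2} := by
    ext z
    simp [T, Prod.ext_iff]
  rw [hrect, measureReal_prod_prod]
  rfl

theorem eventually_exists_dist_prod_lt {A B : ℕ → PMP Γ} {a b : PMP Γ} {S : Finset Γ}
    (hA : ∀ k' : ℕ, 0 < k' →
      Tendsto (fun i => Metric.hausdorffDist ((A i).C S k') (a.C S k')) atTop (𝓝 0))
    (hB : ∀ k' : ℕ, 0 < k' →
      Tendsto (fun i => Metric.hausdorffDist ((B i).C S k') (b.C S k')) atTop (𝓝 0))
    {k : ℕ} (hk : 0 < k) {v : ↥S × Fin k × Fin k → ℝ} (hv : v ∈ (a.prod b).C S k)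
    {ε : ℝ} (hε : 0 < ε) :
    ∀ᶠ i in atTop, ∃ w ∈ ((A i).prod (B i)).C S k, dist v w < ε := by
  obtain ⟨f, hf, hvf⟩ := (a.prod b).exists_dist_M_lt_of_mem_C hv (ε := ε / 3) (by positivity)
  obtain ⟨m, n, g, h, F, hg, hh, hne⟩ := exists_partition_measureReal_ne_lt
    (a.μ.prod b.μ) hk hf (ε := ε / 6) (by positivity)
  have hm : 0 < m := by
    have := nonempty_of_isProbabilityMeasure a.μ
    exact (g (Classical.arbitrary _)).pos
  have hn : 0 < n := by
    have := nonempty_of_isProbabilityMeasure b.μ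
    exact (h (Classical.arbitrary _)).pos
  have hcomp : ∀ {c d : PMP Γ} {g : c.X → Fin m} {h : d.X → Fin n}, Measurable g →
      Measurable h → Measurable fun z : (c.prod d).X => F (g z.1, h z.2) := fun hg hh =>
    (Measurable.of_discrete (f := F)).comp
      ((hg.comp measurable_fst).prodMk (hh.comp measurable_snd))
  have hfF : dist ((a.prod b).M S k f) (combine F (a.M S m g, b.M S n h)) < ε / 3 := by
    rw [← M_prod_comp a b S hg hh F]
    refine ((a.prod b).dist_M_le_s10 S hf (hcomp hg hh)).trans_lt ?_
    have : (a.prod b).μ.real {z | f z ≠ F (g z.1, h z.2)} < ε / 6 := hne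
    linarith
  obtain ⟨δ, hδ, hcont⟩ := Metric.continuous_iff.1 (continuous_combine F)
    (a.M S m g, b.M S n h) (ε / 3) (by positivity)
  filter_upwards [eventually_exists_dist_M_lt (hA m hm) hg hδ,
    eventually_exists_dist_M_lt (hB n hn) hh hδ] with i ⟨g', hg', hgd⟩ ⟨h', hh', hhd⟩
  refine ⟨_, ((A i).prod (B i)).M_mem_C S (hcomp hg' hh'), ?_⟩
  rw [M_prod_comp (A i) (B i) S hg' hh' F]
  have hlast := hcont ((A i).M S m g', (B i).M S n h') (max_lt hgd hhd)
  rw [dist_comm] at hlast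
  linarith [dist_triangle4 v ((a.prod b).M S k f) (combine F (a.M S m g, b.M S n h))
    (combine F ((A i).M S m g', (B i).M S n h'))]

end PMP

/-- (From the proof of Theorem 4.2, the "lower semicontinuity" half, inclusion (4.3).)
If `α_i → α` and `β_i → β` in the topology of the space of weak equivalence classes, then
with no further assumptions, for every finite `S ⊆ Γ`, `k ∈ ℕ⁺` and `ε > 0` one has
`C(α×β,S,k) ⊆ Ball_ε(C(α_i×β_i,S,k))` for all sufficiently large `i`, i.e. every point of
`C(α×β,S,k)` is at `dist_∞`-distance `< ε` from `C(α_i×β_i,S,k)`. -/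
theorem prod_lower_semicontinuous {Γ : Type} [Group Γ] [Countable Γ] [Infinite Γ]
    (A B : ℕ → PMP Γ) (a b : PMP Γ)
    (hA : ∀ (S' : Finset Γ) (k' : ℕ), 0 < k' →
      Tendsto (fun i => Metric.hausdorffDist ((A i).C S' k') (a.C S' k')) atTop (𝓝 0))
    (hB : ∀ (S' : Finset Γ) (k' : ℕ), 0 < k' →
      Tendsto (fun i => Metric.hausdorffDist ((B i).C S' k') (b.C S' k')) atTop (𝓝 0)) :
    ∀ (S : Finset Γ) (k : ℕ), 0 < k → ∀ ε : ℝ, 0 < ε →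
      ∀ᶠ i in atTop, ∀ v ∈ (a.prod b).C S k,
        ∃ w ∈ ((A i).prod (B i)).C S k, dist v w < ε := by
  intro S k hk ε hε
  obtain ⟨t, htC, htfin, hcover⟩ :=
    ((a.prod b).isCompact_C S k).finite_cover_balls (half_pos hε)
  have hnet := htfin.eventually_all.2 fun u hu =>
    PMP.eventually_exists_dist_prod_lt (hA S) (hB S) hk (htC hu) (half_pos hε)
  filter_upwards [hnet] with i hi v hv
  obtain ⟨u, hu, hvu⟩ := Set.mem_iUnion₂.1 (hcover hv)
  obtain ⟨w, hw, huw⟩ := hi u hu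
  refine ⟨w, hw, ?_⟩
  linarith [dist_triangle v u w, Metric.mem_ball.1 hvu]
end

section
/- Let d ≥ 2 and let n, m ≥ 2 be integers with n dividing m, and let p be the smallest prime divisor of n. Set G_n := SL_d(ℤ/nℤ) and G_m := SL_d(ℤ/mℤ), and let π_n: G_m → G_n be reduction modulo n. Then for all functions ζ, η: G_n → ℂ and ξ: G_m → ℂ, ‖(ζ ∗ η) ⊛ ξ − (Eζ)(Eη)(Eξ)·|G_n|·|G_m|‖_∞ ≤ √(2|G_m|/(p−1))·‖ζ‖₂·‖η‖₂·‖ξ‖₂, where the constant function (Eζ)(Eη)(Eξ)·|G_n|·|G_m| is subtracted pointwise. -/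
/-- `G_n = SL_d(ℤ/nℤ)`. -/
abbrev SLmod (d n : ℕ) := Matrix.SpecialLinearGroup (Fin d) (ZMod n)

/-- Reduction modulo `n`, as a homomorphism `SL_d(ℤ) → SL_d(ℤ/nℤ)`. -/
def redZ (d n : ℕ) : Matrix.SpecialLinearGroup (Fin d) ℤ →* SLmod d n :=
  Matrix.SpecialLinearGroup.map (Int.castRingHom (ZMod n))

/-- Reduction modulo `n`, as a homomorphism `SL_d(ℤ/mℤ) → SL_d(ℤ/nℤ)`, when `n ∣ m`. -/
def redMod (d : ℕ) {n m : ℕ} (h : n ∣ m) : SLmod d m →* SLmod d n :=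
  Matrix.SpecialLinearGroup.map (ZMod.castHom h (ZMod n))

/-- The average `E ζ = |G|⁻¹ Σ_x ζ(x)` of a function on a finite group. -/
noncomputable def Eavg {G : Type*} [Fintype G] (ζ : G → ℂ) : ℂ :=
  (∑ x, ζ x) / (Fintype.card G)

/-- The ℓ²-norm `‖ζ‖₂ = (Σ_x |ζ(x)|²)^{1/2}`. -/
noncomputable def l2norm {G : Type*} [Fintype G] (ζ : G → ℂ) : ℝ :=
  Real.sqrt (∑ x, ‖ζ x‖ ^ 2)

/-- Convolution on a finite group: `(ζ ∗ η)(x) = Σ_{ab = x} ζ(a) η(b)`. -/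
noncomputable def conv {G : Type*} [Group G] [Fintype G] (ζ η : G → ℂ) : G → ℂ :=
  fun x => ∑ a, ζ a * η (a⁻¹ * x)

/-- The twisted convolution `(ζ ⊛ ξ)(x) = Σ_{a·π(b) = x} ζ(a) ξ(b)`, where `π : G_m → G_n`. -/
noncomputable def circConv {Gn Gm : Type*} [Group Gn] [Fintype Gm]
    (π : Gm → Gn) (ζ : Gn → ℂ) (ξ : Gm → ℂ) : Gn → ℂ :=
  fun x => ∑ b, ζ (x * (π b)⁻¹) * ξ b

section Generation

open Matrix Matrix.SpecialLinearGroup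

/-- In `ℤ/nℤ`, a coprime pair `(a, b)` can be shortened to a unit `a + c b`. -/
theorem ZMod.exists_isUnit_add_mul {n : ℕ} [NeZero n] {a b : ZMod n} (h : IsCoprime a b) :
    ∃ c, IsUnit (a + c * b) := by
  set ps : Finset ℕ := {p ∈ n.primeFactors | ¬p ∣ a.val} with hps
  set c : ℕ := ∏ p ∈ ps, p with hc
  refine ⟨c, ?_⟩
  have key : (a.val + c * b.val).Coprime n := by
    refine Nat.coprime_of_dvd fun p pp hp hpn ↦ ?_
    by_cases hpa : p ∣ a.val
    · rcases pp.dvd_mul.mp ((Nat.dvd_add_right hpa).mp hp) with h' | hpb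
      · obtain ⟨q, hq, hpq⟩ := (pp.prime.dvd_finsetProd_iff id).mp h'
        rw [hps, Finset.mem_filter, Nat.mem_primeFactors] at hq
        exact hq.2 (((Nat.prime_dvd_prime_iff_eq pp hq.1.1).mp hpq) ▸ hpa)
      · obtain ⟨u, v, huv⟩ := h
        have : Fact p.Prime := ⟨pp⟩
        have hz : ∀ x : ZMod n, p ∣ x.val → ZMod.castHom hpn (ZMod p) x = 0 := fun x hx ↦ by
          rw [← ZMod.natCast_zmod_val x, map_natCast]
          exact (ZMod.natCast_eq_zero_iff _ _).mpr hx
        have := congrArg (ZMod.castHom hpn (ZMod p)) huv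
        simp only [map_add, map_mul, hz a hpa, hz b hpb, map_one] at this
        simp at this
    · have hmem : p ∈ ps :=
        Finset.mem_filter.mpr ⟨Nat.mem_primeFactors.mpr ⟨pp, hpn, NeZero.ne n⟩, hpa⟩
      exact hpa ((Nat.dvd_add_left ((Finset.dvd_prod_of_mem id hmem).mul_right _)).mp hp)
  simpa using (ZMod.isUnit_iff_coprime _ _).mpr key

namespace Matrix.SpecialLinearGroup

variable {ι R : Type*} [DecidableEq ι] [Fintype ι] [CommRing R]

variable (ι R) in
/-- The elementary subgroup of `SL(ι, R)`, generated by the transvections. -/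
def elementary : Subgroup (SpecialLinearGroup ι R) :=
  Subgroup.closure {g | ∃ (i j : ι) (h : i ≠ j) (c : R), g = transvection h c}

theorem transvection_mem_elementary {i j : ι} (h : i ≠ j) (c : R) :
    transvection h c ∈ elementary ι R :=
  Subgroup.subset_closure ⟨i, j, h, c, rfl⟩

theorem exists_mem_elementary_col (k : ι) (f : ι → R) (s : Finset ι) (hk : k ∉ s) :
    ∃ g ∈ elementary ι R, (g : Matrix ι ι R) = 1 + ∑ i ∈ s, single i k (f i) := by
  induction s using Finset.induction_on with
  | empty => exact ⟨1, one_mem _, by simp⟩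
  | insert a s ha ih =>
    obtain ⟨g, hg, hgm⟩ := ih fun h ↦ hk (Finset.mem_insert_of_mem h)
    have hak : a ≠ k := fun h ↦ hk (h ▸ Finset.mem_insert_self _ _)
    refine ⟨transvection hak (f a) * g, mul_mem (transvection_mem_elementary _ _) hg, ?_⟩
    have : single a k (f a) * ∑ i ∈ s, single i k (f i) = 0 := by
      rw [Finset.mul_sum]
      refine Finset.sum_eq_zero fun i hi ↦ single_mul_single_of_ne _ _ _ _ ?_ _
      rintro rfl
      exact hk (Finset.mem_insert_of_mem hi)
    rw [coe_mul, hgm, transvection_coe, Finset.sum_insert ha, add_mul, mul_add (single _ _ _), this]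
    simp only [one_mul, mul_one, add_zero]
    abel

theorem exists_mem_elementary_row (k : ι) (f : ι → R) (s : Finset ι) (hk : k ∉ s) :
    ∃ g ∈ elementary ι R, (g : Matrix ι ι R) = 1 + ∑ i ∈ s, single k i (f i) := by
  induction s using Finset.induction_on with
  | empty => exact ⟨1, one_mem _, by simp⟩
  | insert a s ha ih =>
    obtain ⟨g, hg, hgm⟩ := ih fun h ↦ hk (Finset.mem_insert_of_mem h)
    have hka : k ≠ a := fun h ↦ hk (h ▸ Finset.mem_insert_self _ _)
    refine ⟨transvection hka (f a) * g, mul_mem (transvection_mem_elementary _ _) hg, ?_⟩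
    have : single k a (f a) * ∑ i ∈ s, single k i (f i) = 0 := by
      rw [Finset.mul_sum]
      exact Finset.sum_eq_zero fun i hi ↦ single_mul_single_of_ne _ _ _ _ hka.symm _
    rw [coe_mul, hgm, transvection_coe, Finset.sum_insert ha, add_mul, mul_add (single _ _ _), this]
    simp only [one_mul, mul_one, add_zero]
    abel

/-- Adding multiples of row `k` to the rows in `s` is multiplication by an elementary matrix. -/
theorem exists_add_row_mul (k : ι) (f : ι → R) (s : Finset ι) (hk : k ∉ s) :
    ∃ g ∈ elementary ι R, ∀ A : SpecialLinearGroup ι R, ∀ i j,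
      (g * A) i j = A i j + (if i ∈ s then f i * A k j else 0) := by
  obtain ⟨g, hg, hgm⟩ := exists_mem_elementary_col k f s hk
  refine ⟨g, hg, fun A i j ↦ ?_⟩
  rw [coe_mul, hgm, add_mul, one_mul, Matrix.add_apply, Finset.sum_mul, Matrix.sum_apply]
  congr 1
  simp [Matrix.mul_apply, Matrix.single_apply, ite_and]

/-- Adding a combination of the rows in `s` to row `k` is multiplication by an elementary
matrix. -/
theorem exists_add_sum_row (k : ι) (f : ι → R) (s : Finset ι) (hk : k ∉ s) :
    ∃ g ∈ elementary ι R, ∀ A : SpecialLinearGroup ι R, ∀ i j,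
      (g * A) i j = A i j + (if i = k then ∑ l ∈ s, f l * A l j else 0) := by
  obtain ⟨g, hg, hgm⟩ := exists_mem_elementary_row k f s hk
  refine ⟨g, hg, fun A i j ↦ ?_⟩
  rw [coe_mul, hgm, add_mul, one_mul, Matrix.add_apply, Finset.sum_mul, Matrix.sum_apply]
  congr 1
  simp [Matrix.mul_apply, Matrix.single_apply, ite_and, eq_comm (a := k)]

/-- Adding multiples of column `k` to the columns in `s` is multiplication by an elementary
matrix. -/
theorem exists_add_col_mul (k : ι) (f : ι → R) (s : Finset ι) (hk : k ∉ s) :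
    ∃ g ∈ elementary ι R, ∀ A : SpecialLinearGroup ι R, ∀ i j,
      (A * g) i j = A i j + (if j ∈ s then A i k * f j else 0) := by
  obtain ⟨g, hg, hgm⟩ := exists_mem_elementary_row k f s hk
  refine ⟨g, hg, fun A i j ↦ ?_⟩
  rw [coe_mul, hgm, mul_add, mul_one, Matrix.add_apply, Finset.mul_sum, Matrix.sum_apply]
  congr 1
  simp [Matrix.mul_apply, Matrix.single_apply, ite_and]

/-- Over a commutative ring of stable rank one, `SL` is generated by transvections. -/
theorem elementary_eq_top
    (hR : ∀ a b : R, IsCoprime a b → ∃ c, IsUnit (a + c * b)) : elementary ι R = ⊤ := by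
  suffices H : ∀ (t : Finset ι) (A : SpecialLinearGroup ι R),
      (∀ i j, i ∉ t ∨ j ∉ t → A i j = (1 : Matrix ι ι R) i j) → A ∈ elementary ι R from
    eq_top_iff.mpr fun A _ ↦ H Finset.univ A (by simp)
  intro t
  induction t using Finset.induction_on with
  | empty =>
    intro A hA
    have : A = 1 := by ext i j; simpa using hA i j (by simp)
    exact this ▸ one_mem _
  | insert k t hk ih =>
    intro A hA
    rcases t.eq_empty_or_nonempty with rfl | ⟨l, hl⟩
    · have hd : (A : Matrix ι ι R) = diagonal fun i ↦ A i i := by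
        ext i j
        by_cases hij : i = j
        · simp [hij]
        · rw [diagonal_apply_ne _ hij, hA i j (by
            by_contra! h
            simp only [Finset.mem_insert, Finset.notMem_empty, or_false] at h
            exact hij (h.1.trans h.2.symm)), one_apply_ne hij]
      have hdet := A.det_coe
      rw [hd, det_diagonal, Finset.prod_eq_single k
        (fun b _ hb ↦ by rw [hA b b (by simp [hb]), one_apply_eq]) (by simp)] at hdet
      have : A = 1 := by
        ext i j
        rw [hd]
        by_cases hij : i = j
        · subst hij
          by_cases hik : i = k
          · subst hik; simpa using hdet
          · simpa using hA i i (by simp [hik])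
        · simp [hij]
      exact this ▸ one_mem _
    have hlk : l ≠ k := fun h ↦ hk (h ▸ hl)
    -- make the entry `(l, k)` a unit
    have hcol : ∑ i ∈ insert k t, (A⁻¹) k i * A i k = 1 := by
      have h1 : ((A⁻¹ * A : SpecialLinearGroup ι R) : Matrix ι ι R) k k = 1 := by simp
      rw [coe_mul, Matrix.mul_apply] at h1
      refine Eq.trans ?_ h1
      refine Finset.sum_subset (Finset.subset_univ _) fun i _ hi ↦ ?_
      have hik : i ≠ k := fun h ↦ hi (by simp [h])
      rw [hA i k (Or.inl hi), one_apply_ne hik, mul_zero]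
    obtain ⟨c, hc⟩ := hR (A l k) (∑ i ∈ (insert k t).erase l, (A⁻¹) k i * A i k)
      ⟨(A⁻¹) k l, 1, by rw [one_mul, Finset.add_sum_erase _
        (fun i ↦ (A⁻¹) k i * A i k) (Finset.mem_insert_of_mem hl), hcol]⟩
    obtain ⟨g₁, hg₁, h₁⟩ := exists_add_sum_row l (fun i ↦ c * (A⁻¹) k i) ((insert k t).erase l)
      (by simp)
    set A₁ := g₁ * A with hA₁
    have hA₁lk : IsUnit (A₁ l k) := by
      rw [h₁, if_pos rfl]
      simpa [Finset.mul_sum, mul_assoc] using hc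
    have hA₁' : ∀ i j, i ∉ insert k t ∨ j ∉ insert k t → A₁ i j = (1 : Matrix ι ι R) i j := by
      intro i j hij
      rw [h₁, hA i j hij]
      split_ifs with hil
      · subst hil
        have hj := hij.resolve_left (not_not.mpr (Finset.mem_insert_of_mem hl))
        rw [Finset.sum_eq_zero, add_zero]
        intro x hx
        have hxj : x ≠ j := fun h ↦ hj (h ▸ Finset.mem_of_mem_erase hx)
        rw [hA x j (Or.inr hj), one_apply_ne hxj, mul_zero]
      · rw [add_zero]
    -- make the entry `(k, k)` equal to `1`
    obtain ⟨u, hu⟩ := hA₁lk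
    obtain ⟨g₂, hg₂, h₂⟩ := exists_add_row_mul l (fun _ ↦ (1 - A₁ k k) * (↑u⁻¹ : R)) {k}
      (by simpa using hlk)
    set A₂ := g₂ * A₁ with hA₂
    have hA₂kk : A₂ k k = 1 := by
      rw [h₂, ← hu]
      simp [mul_assoc]
    have hA₂' : ∀ i j, i ∉ insert k t ∨ j ∉ insert k t → A₂ i j = (1 : Matrix ι ι R) i j := by
      intro i j hij
      rw [h₂, hA₁' i j hij]
      split_ifs with hik
      · rw [Finset.mem_singleton] at hik
        subst hik
        have hj := hij.resolve_left (not_not.mpr (Finset.mem_insert_self _ _))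
        have hlj : l ≠ j := fun h ↦ hj (h ▸ Finset.mem_insert_of_mem hl)
        rw [hA₁' l j (Or.inr hj), one_apply_ne hlj, mul_zero, add_zero]
      · rw [add_zero]
    -- clear column `k` and then row `k`
    obtain ⟨g₃, hg₃, h₃⟩ := exists_add_row_mul k (fun i ↦ -A₂ i k) t hk
    set A₃ := g₃ * A₂ with hA₃
    obtain ⟨g₄, hg₄, h₄⟩ := exists_add_col_mul k (fun j ↦ -A₃ k j) t hk
    have hA₃k : ∀ i, A₃ i k = (1 : Matrix ι ι R) i k := by
      intro i
      rw [h₃, hA₂kk]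
      by_cases hi : i ∈ t
      · have hik : i ≠ k := fun h ↦ hk (h ▸ hi)
        simp [hi, hik]
      · by_cases hik : i = k
        · subst hik; simp [hk, hA₂kk]
        · rw [hA₂' i k (by simp [hi, hik])]; simp [hi]
    have hA₃' : ∀ i j, i ∉ insert k t ∨ j ∉ insert k t → A₃ i j = (1 : Matrix ι ι R) i j := by
      intro i j hij
      rw [h₃, hA₂' i j hij]
      split_ifs with hi
      · have hj := hij.resolve_left (not_not.mpr (Finset.mem_insert_of_mem hi))
        have hkj : k ≠ j := fun h ↦ hj (h ▸ Finset.mem_insert_self _ _)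
        rw [hA₂' k j (Or.inr hj), one_apply_ne hkj, mul_zero, add_zero]
      · rw [add_zero]
    have hA₄ : A₃ * g₄ ∈ elementary ι R := by
      refine ih _ fun i j hij ↦ ?_
      rw [h₄, hA₃k]
      by_cases hik : i = k
      · subst hik
        by_cases hj : j ∈ t
        · have hij' : i ≠ j := fun h ↦ hk (h ▸ hj)
          simp [hj, hij']
        · by_cases hji : j = i
          · subst hji; simp [hj, hA₃k]
          · rw [hA₃' i j (by simp [hj, hji])]; simp [hj]
      · rw [one_apply_ne hik]
        by_cases hjk : j = k
        · subst hjk; simp [hA₃k]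
        · rw [hA₃' i j (by simpa [hik, hjk] using hij)]; simp
    rw [Subgroup.mul_mem_cancel_right _ hg₄, hA₃, Subgroup.mul_mem_cancel_left _ hg₃, hA₂,
      Subgroup.mul_mem_cancel_left _ hg₂, hA₁, Subgroup.mul_mem_cancel_left _ hg₁] at hA₄
    exact hA₄

theorem elementary_zmod_eq_top (n : ℕ) [NeZero n] : elementary ι (ZMod n) = ⊤ :=
  elementary_eq_top fun _ _ ↦ ZMod.exists_isUnit_add_mul

end Matrix.SpecialLinearGroup

theorem redMod_surjective (d : ℕ) {n m : ℕ} [NeZero n] (h : n ∣ m) :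
    Function.Surjective (redMod d h) := by
  rw [← MonoidHom.range_eq_top, eq_top_iff, ← elementary_zmod_eq_top, elementary,
    Subgroup.closure_le]
  rintro _ ⟨i, j, hij, c, rfl⟩
  obtain ⟨c, rfl⟩ := ZMod.castHom_surjective h c
  refine ⟨transvection hij c, ?_⟩
  refine Subtype.ext ?_
  change (ZMod.castHom h (ZMod n)).mapMatrix (1 + single i j c) =
    1 + single i j (ZMod.castHom h (ZMod n) c)
  rw [map_add, map_one, RingHom.mapMatrix_apply, Matrix.map_single]

end Generation

section Quasirandom

open Matrix Matrix.SpecialLinearGroup Module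

/-- A nontrivial linear operator with `u ^ n = 1` has an eigenvalue different from `1`. -/
theorem Module.End.exists_hasEigenvalue_ne_one {V : Type*} [AddCommGroup V] [Module ℂ V]
    [FiniteDimensional ℂ V] {u : End ℂ V} {n : ℕ} (hn : n ≠ 0) (hu : u ^ n = 1) (h : u ≠ 1) :
    ∃ ω : ℂ, ω ^ n = 1 ∧ ω ≠ 1 ∧ u.HasEigenvalue ω := by
  set s : End ℂ V := ∑ k ∈ Finset.range n, u ^ k with hs
  have hs0 : s * (u - 1) = 0 := by rw [hs, geom_sum_mul, hu, sub_self]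
  have hcomm : Commute s u := Commute.sum_left _ _ _ fun k _ ↦ (Commute.refl u).pow_left k
  have hinv : ∀ v ∈ LinearMap.ker s, u v ∈ LinearMap.ker s := fun v hv ↦ by
    rw [LinearMap.mem_ker] at hv ⊢
    rw [← Module.End.mul_apply, hcomm.eq, Module.End.mul_apply, hv, map_zero]
  obtain ⟨v, hv⟩ : ∃ v, (u - 1) v ≠ 0 := by
    by_contra! hc
    exact h (sub_eq_zero.mp (LinearMap.ext hc))
  have hvk : (u - 1) v ∈ LinearMap.ker s := LinearMap.congr_fun hs0 v
  have : Nontrivial (LinearMap.ker s) := ⟨⟨⟨_, hvk⟩, 0, fun h ↦ hv (congrArg Subtype.val h)⟩⟩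
  obtain ⟨ω, hω⟩ := Module.End.exists_eigenvalue (u.restrict hinv)
  obtain ⟨⟨w, hwk⟩, hw⟩ := hω.exists_hasEigenvector
  have hw0 : w ≠ 0 := fun h ↦ hw.2 (Subtype.ext h)
  have hev : u.HasEigenvector ω w :=
    ⟨Module.End.mem_eigenspace_iff.mpr (congrArg Subtype.val hw.apply_eq_smul), hw0⟩
  have hpow : ∀ k, (u ^ k) w = ω ^ k • w := fun k ↦ hev.pow_apply k
  refine ⟨ω, ?_, ?_, Module.End.hasEigenvalue_of_hasEigenvector hev⟩
  · have := hpow n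
    rw [hu, Module.End.one_apply] at this
    by_contra hne
    refine hw0 ((smul_eq_zero.mp (?_ : (ω ^ n - 1) • w = 0)).resolve_left (sub_ne_zero.mpr hne))
    rw [sub_smul, ← this, one_smul, sub_self]
  · rintro rfl
    have h0 : s w = 0 := hwk
    rw [hs, LinearMap.sum_apply] at h0
    simp only [hpow, one_pow, one_smul, Finset.sum_const, Finset.card_range] at h0
    have : (n : ℂ) • w = 0 := by rwa [Nat.cast_smul_eq_nsmul]
    exact (smul_eq_zero.mp this).elim (by exact_mod_cast hn) hw0

/-- Finitely many eigenvalues number at most the dimension. -/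
theorem Module.End.card_le_finrank_of_hasEigenvalue {V : Type*} [AddCommGroup V] [Module ℂ V]
    [FiniteDimensional ℂ V] {u : End ℂ V} (s : Finset ℂ) (hs : ∀ μ ∈ s, u.HasEigenvalue μ) :
    s.card ≤ finrank ℂ V := by
  rw [← LinearMap.charpoly_natDegree u]
  refine (Finset.card_le_card fun μ hμ ↦ ?_).trans
    ((Multiset.toFinset_card_le _).trans (LinearMap.charpoly u).card_roots')
  rw [Multiset.mem_toFinset, Polynomial.mem_roots (LinearMap.charpoly_monic u).ne_zero]
  exact (Module.End.hasEigenvalue_iff_isRoot_charpoly u μ).mp (hs μ hμ)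

/-- Conjugating a transvection by a diagonal matrix scales it by the square of a unit. -/
theorem Matrix.SpecialLinearGroup.exists_mul_transvection_eq {ι R : Type*} [DecidableEq ι]
    [Fintype ι] [CommRing R] {i j : ι} (hij : i ≠ j) (t : Rˣ) :
    ∃ h : SpecialLinearGroup ι R,
      h * transvection hij 1 = transvection hij ((t : R) ^ 2) * h := by
  set D : ι → R := fun k ↦ if k = i then (t : R) else if k = j then (↑t⁻¹ : R) else 1 with hD
  have hdet : (diagonal D).det = 1 := by
    rw [det_diagonal, ← Finset.mul_prod_erase _ _ (Finset.mem_univ i),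
      ← Finset.mul_prod_erase _ _ (Finset.mem_erase.mpr ⟨hij.symm, Finset.mem_univ j⟩),
      Finset.prod_eq_one]
    · simp [hD, hij.symm]
    · intro k hk
      simp only [Finset.mem_erase] at hk
      simp [hD, hk.1, hk.2.1]
  refine ⟨⟨diagonal D, hdet⟩, Subtype.ext ?_⟩
  change diagonal D * (1 + single i j 1) = (1 + single i j ((t : R) ^ 2)) * diagonal D
  ext a b
  simp only [diagonal_mul, mul_diagonal, Matrix.add_apply, Matrix.single_apply, Matrix.one_apply]
  by_cases hab : a = b
  · subst hab
    have : ¬ (i = a ∧ j = a) := fun h ↦ hij (h.1.trans h.2.symm)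
    simp [this]
  · by_cases h : i = a ∧ j = b
    · obtain ⟨rfl, rfl⟩ := h
      simp [hD, hij, hij.symm, pow_two, mul_assoc]
    · simp [hab, h]

/-- A representation of `SL_d(ℤ/nℤ)` in which some transvection acts nontrivially has dimension
at least `(p - 1) / 2`, where `p` is the smallest prime factor of `n`. -/
theorem minFac_sub_one_le_of_transvection_ne_one {d n : ℕ} [NeZero n] {V : Type*}
    [AddCommGroup V] [Module ℂ V] [FiniteDimensional ℂ V] (ρ : Representation ℂ (SLmod d n) V)
    {i j : Fin d} (hij : i ≠ j) (c : ZMod n) (h : ρ (transvection hij c) ≠ 1) :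
    n.minFac - 1 ≤ 2 * finrank ℂ V := by
  have hpow : ∀ k : ℕ, ρ (transvection hij 1) ^ k = ρ (transvection hij (k : ZMod n)) := by
    intro k
    induction k with
    | zero => rw [pow_zero, Nat.cast_zero, transvection_coeff_zero, map_one]
    | succ k ih => rw [pow_succ, ih, ← map_mul, ← transvection_add, Nat.cast_succ]
  set u : End ℂ V := ρ (transvection hij 1) with hu
  have hun : u ^ n = 1 := by
    rw [hpow, ZMod.natCast_self, transvection_coeff_zero, map_one]
  have hu1 : u ≠ 1 := by
    intro h1
    apply h
    rw [← ZMod.natCast_zmod_val c, ← hpow, h1, one_pow]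
  obtain ⟨ω, hωn, hω1, hωev⟩ := Module.End.exists_hasEigenvalue_ne_one (NeZero.ne n) hun hu1
  have hord : orderOf ω ∣ n := orderOf_dvd_of_pow_eq_one hωn
  have hord1 : orderOf ω ≠ 1 := fun h ↦ hω1 (orderOf_eq_one_iff.mp h)
  set q := (orderOf ω).minFac with hq
  have hqp : q.Prime := Nat.minFac_prime hord1
  have : Fact q.Prime := ⟨hqp⟩
  have hqo : q ∣ orderOf ω := Nat.minFac_dvd _
  have hqn : q ∣ n := hqo.trans hord
  have hpq : n.minFac ≤ q := Nat.minFac_le_of_dvd hqp.two_le hqn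
  have hev : ∀ t : (ZMod n)ˣ, u.HasEigenvalue (ω ^ ((t : ZMod n) ^ 2).val) := by
    intro t
    obtain ⟨g, hg⟩ := exists_mul_transvection_eq hij t
    obtain ⟨v, hv⟩ := hωev.exists_hasEigenvector
    have hcomm : ρ g * u = u ^ ((t : ZMod n) ^ 2).val * ρ g := by
      rw [hpow, ZMod.natCast_zmod_val, hu, ← map_mul, hg, map_mul]
    have hg' : u * ρ g⁻¹ = ρ g⁻¹ * u ^ ((t : ZMod n) ^ 2).val := by
      have h1 : ρ g⁻¹ * ρ g = 1 := by rw [← map_mul, inv_mul_cancel, map_one]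
      have h2 : ρ g * ρ g⁻¹ = 1 := by rw [← map_mul, mul_inv_cancel, map_one]
      calc u * ρ g⁻¹ = ρ g⁻¹ * (ρ g * u) * ρ g⁻¹ := by rw [← mul_assoc, h1, one_mul]
        _ = _ := by rw [hcomm, mul_assoc, mul_assoc, h2, mul_one]
    refine Module.End.hasEigenvalue_of_hasEigenvector (x := ρ g⁻¹ v)
      ⟨Module.End.mem_eigenspace_iff.mpr ?_, fun h0 ↦ hv.2 ?_⟩
    · rw [← Module.End.mul_apply, hg', Module.End.mul_apply, hv.pow_apply, map_smul]
    · have h2 : ρ g * ρ g⁻¹ = 1 := by rw [← map_mul, mul_inv_cancel, map_one]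
      rw [← Module.End.one_apply (R := ℂ) v, ← h2, Module.End.mul_apply, h0, map_zero]
  obtain ⟨σ, hσ⟩ := (ZMod.unitsMap_surjective (m := n) hqn).hasRightInverse
  have hσ' : ∀ y, ZMod.castHom hqn (ZMod q) (σ y : ZMod n) = y := fun y ↦
    congrArg Units.val (hσ y)
  set F : (ZMod q)ˣ → ℂ := fun y ↦ ω ^ ((σ y : ZMod n) ^ 2).val with hF
  have hFeq : ∀ y z, F y = F z → y = z ∨ y = -z := by
    intro y z hyz
    have hωu : ω ^ ((σ y : ZMod n) ^ 2).val = ω ^ ((σ z : ZMod n) ^ 2).val := hyz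
    have hmod : ((σ y : ZMod n) ^ 2).val ≡ ((σ z : ZMod n) ^ 2).val [MOD orderOf ω] := by
      obtain ⟨w, hw⟩ : IsUnit ω := IsUnit.of_pow_eq_one hωn (NeZero.ne n)
      rw [← hw, ← Units.val_pow_eq_pow_val, ← Units.val_pow_eq_pow_val] at hωu
      rw [← hw, orderOf_units]
      exact pow_eq_pow_iff_modEq.mp (Units.ext hωu)
    have hmod' : ((σ y : ZMod n) ^ 2).val ≡ ((σ z : ZMod n) ^ 2).val [MOD q] :=
      hmod.of_dvd hqo
    have hcast := (ZMod.natCast_eq_natCast_iff _ _ _).mpr hmod'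
    have hval : ∀ w : ZMod n, ((w.val : ℕ) : ZMod q) = ZMod.castHom hqn (ZMod q) w := fun w ↦ by
      conv_rhs => rw [← ZMod.natCast_zmod_val w, map_natCast]
    rw [hval, hval, map_pow, map_pow, hσ', hσ'] at hcast
    rcases sq_eq_sq_iff_eq_or_eq_neg.mp hcast with h' | h'
    · exact Or.inl (Units.ext h')
    · exact Or.inr (Units.ext (by simpa using h'))
  have hcard := Finset.card_le_mul_card_image (f := F) Finset.univ 2 fun b hb ↦ by
    obtain ⟨z, -, rfl⟩ := Finset.mem_image.mp hb
    refine (Finset.card_le_card (t := {z, -z}) fun y hy ↦ ?_).trans Finset.card_le_two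
    simpa using hFeq y z (Finset.mem_filter.mp hy).2
  have hfin := Module.End.card_le_finrank_of_hasEigenvalue (u := u) (Finset.univ.image F)
    fun μ hμ ↦ by
      obtain ⟨z, -, rfl⟩ := Finset.mem_image.mp hμ
      exact hev _
  rw [Finset.card_univ, ZMod.card_units] at hcard
  omega

/-- Every representation of `SL_d(ℤ/nℤ)` with a non-invariant vector has dimension at least
`(p - 1) / 2`, where `p` is the smallest prime factor of `n`. -/
theorem minFac_sub_one_le_finrank {d n : ℕ} [NeZero n] {V : Type*}
    [AddCommGroup V] [Module ℂ V] [FiniteDimensional ℂ V] (ρ : Representation ℂ (SLmod d n) V)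
    (h : ∃ g, ρ g ≠ 1) : n.minFac - 1 ≤ 2 * finrank ℂ V := by
  by_contra hlt
  obtain ⟨g, hg⟩ := h
  refine hg (?_ : g ∈ ρ.ker)
  suffices elementary (Fin d) (ZMod n) ≤ ρ.ker from
    this (elementary_zmod_eq_top (ι := Fin d) n ▸ Subgroup.mem_top g)
  rw [elementary, Subgroup.closure_le]
  rintro _ ⟨i, j, hij, c, rfl⟩
  by_contra hne
  exact hlt (minFac_sub_one_le_of_transvection_ne_one ρ hij c hne)

end Quasirandom

section Convolution

variable {G : Type*} [Group G] [Fintype G]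

theorem conv_apply (ζ η : G → ℂ) (x : G) : conv ζ η x = ∑ y, ζ (x * y⁻¹) * η y :=
  Fintype.sum_equiv ((Equiv.inv G).trans (Equiv.mulRight x)) _ _ fun a ↦ by simp

theorem sum_conv (ζ η : G → ℂ) : ∑ x, conv ζ η x = (∑ x, ζ x) * ∑ x, η x := by
  simp only [conv]
  rw [Finset.sum_comm, Finset.sum_mul]
  refine Finset.sum_congr rfl fun a _ ↦ ?_
  rw [← Finset.mul_sum]
  congr 1
  exact Fintype.sum_equiv (Equiv.mulLeft a⁻¹) _ _ fun _ ↦ rfl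

theorem conv_translate (ζ η : G → ℂ) (g x : G) :
    conv ζ (fun y ↦ η (y * g)) x = conv ζ η (x * g) := by
  simp [conv, mul_assoc]

/-- Convolution by `f` on the left, as an operator on `ℓ²(G)`. -/
noncomputable def convLin [DecidableEq G] (f : G → ℂ) : EuclideanSpace ℂ G →ₗ[ℂ] EuclideanSpace ℂ G :=
  Matrix.toEuclideanLin (Matrix.of fun x y ↦ f (x * y⁻¹))

theorem convLin_apply [DecidableEq G] (f : G → ℂ) (η : EuclideanSpace ℂ G) (x : G) :
    convLin f η x = conv f η x := by
  rw [conv_apply]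
  rfl

theorem adjoint_convLin_mul [DecidableEq G] (f : G → ℂ) :
    LinearMap.adjoint (convLin f) * convLin f =
      convLin (fun u ↦ ∑ w, starRingEnd ℂ (f w) * f (w * u)) := by
  unfold convLin
  rw [← Matrix.toEuclideanLin_conjTranspose_eq_adjoint]
  ext η x
  change ((Matrix.of fun x y ↦ f (x * y⁻¹)).conjTranspose.mulVec
    ((Matrix.of fun x y ↦ f (x * y⁻¹)).mulVec η)) x = _
  rw [Matrix.mulVec_mulVec]
  change (Matrix.mulVec _ _) x = (Matrix.mulVec _ _) x
  congr 2
  ext a b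
  simp only [Matrix.mul_apply, Matrix.conjTranspose_apply, Matrix.of_apply]
  refine Fintype.sum_equiv (Equiv.mulRight a⁻¹) _ _ fun z ↦ ?_
  simp [mul_assoc]

/-- Right translation, as a representation of `G` on `ℓ²(G)`. -/
noncomputable def rightTranslation (G : Type*) [Group G] [Fintype G] :
    Representation ℂ G (EuclideanSpace ℂ G) where
  toFun g :=
    { toFun := fun η ↦ WithLp.toLp 2 fun y ↦ η (y * g)
      map_add' := fun _ _ ↦ rfl
      map_smul' := fun _ _ ↦ rfl }
  map_one' := by ext; simp
  map_mul' g h := by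
    ext η x
    exact congrArg η (mul_assoc x g h).symm

theorem rightTranslation_apply (g : G) (η : EuclideanSpace ℂ G) (x : G) :
    rightTranslation G g η x = η (x * g) := rfl

/-- If every subspace of `ℓ²(G)` stable under right translation and consisting of functions of mean
zero has dimension at least `D` unless it vanishes, then convolution by a function of mean zero
has norm at most `√(|G| / D) ‖f‖₂`. -/
theorem norm_convLin_sq_le [DecidableEq G] {D : ℝ} (hD : 0 < D)
    (hG : ∀ V : Submodule ℂ (EuclideanSpace ℂ G), V ≠ ⊥ →
      (∀ g, V ≤ V.comap (rightTranslation G g)) → (∀ v ∈ V, ∑ x, v x = 0) →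
      D ≤ Module.finrank ℂ V)
    (f : G → ℂ) (hf : ∑ x, f x = 0) (η : EuclideanSpace ℂ G) :
    ‖convLin f η‖ ^ 2 ≤ Fintype.card G / D * (∑ x, ‖f x‖ ^ 2) * ‖η‖ ^ 2 := by
  set L := convLin f with hL
  set A : EuclideanSpace ℂ G →ₗ[ℂ] EuclideanSpace ℂ G := LinearMap.adjoint L * L with hA
  have hAinner : ∀ v, RCLike.re (inner ℂ (A v) v) = ‖L v‖ ^ 2 := fun v ↦ by
    rw [hA, Module.End.mul_apply, LinearMap.adjoint_inner_left, inner_self_eq_norm_sq]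
  set μ : ℝ := ⨆ v : {v : EuclideanSpace ℂ G // v ≠ 0},
    RCLike.re (inner ℂ (A v) (v : EuclideanSpace ℂ G)) / ‖(v : EuclideanSpace ℂ G)‖ ^ 2 with hμ
  have hev : Module.End.HasEigenvalue A (μ : ℂ) :=
    (LinearMap.isSymmetric_adjoint_mul_self L).hasEigenvalue_iSup_of_finiteDimensional
  have hbdd : BddAbove (Set.range fun v : {v : EuclideanSpace ℂ G // v ≠ 0} ↦
      RCLike.re (inner ℂ (A v) (v : EuclideanSpace ℂ G)) /
        ‖(v : EuclideanSpace ℂ G)‖ ^ 2) := by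
    refine ⟨‖LinearMap.toContinuousLinearMap L‖ ^ 2, ?_⟩
    rintro _ ⟨⟨v, hv⟩, rfl⟩
    simp only [hAinner]
    rw [div_le_iff₀ (by positivity), ← mul_pow]
    gcongr
    exact (LinearMap.toContinuousLinearMap L).le_opNorm v
  have hLμ : ∀ v, ‖L v‖ ^ 2 ≤ μ * ‖v‖ ^ 2 := by
    intro v
    by_cases hv : v = 0
    · simp [hv]
    · rw [← hAinner, ← div_le_iff₀ (by positivity)]
      exact le_ciSup hbdd ⟨v, hv⟩
  suffices hμle : μ ≤ Fintype.card G / D * ∑ x, ‖f x‖ ^ 2 from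
    (hLμ η).trans (by gcongr)
  rcases le_or_gt μ 0 with hμ0 | hμ0
  · exact hμ0.trans (by positivity)
  set V := Module.End.eigenspace A (μ : ℂ) with hV
  have hmemV : ∀ v, v ∈ V ↔ A v = (μ : ℂ) • v := fun v ↦ Module.End.mem_eigenspace_iff
  obtain ⟨k, hk, hk0⟩ : ∃ k : G → ℂ, A = convLin k ∧ ∑ x, k x = 0 := by
    refine ⟨_, adjoint_convLin_mul f, ?_⟩
    rw [Finset.sum_comm]
    refine Finset.sum_eq_zero fun w _ ↦ ?_
    rw [← Finset.mul_sum, Fintype.sum_equiv (Equiv.mulLeft w) (fun u ↦ f (w * u)) f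
      (fun _ ↦ rfl), hf, mul_zero]
  have hdim : D ≤ Module.finrank ℂ V := by
    refine hG V hev (fun g v hv ↦ ?_) fun v hv ↦ ?_
    · rw [Submodule.mem_comap, hmemV]
      rw [hmemV] at hv
      ext x
      have := congrArg (fun w : EuclideanSpace ℂ G ↦ w (x * g)) hv
      simp only [hk, convLin_apply] at this
      rw [hk, convLin_apply]
      exact (conv_translate k v g x).trans this
    · rw [hmemV] at hv
      have h1 : ∑ x, A v x = 0 := by
        simp only [hk, convLin_apply]
        rw [sum_conv, hk0, zero_mul]
      rw [hv] at h1
      simp only [PiLp.smul_apply, smul_eq_mul, ← Finset.mul_sum] at h1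
      exact (mul_eq_zero.mp h1).resolve_left (by exact_mod_cast hμ0.ne')
  -- Compare the Hilbert–Schmidt norm of `L` with its restriction to `V`.
  set b := stdOrthonormalBasis ℂ V with hb
  have hon : Orthonormal ℂ fun i ↦ (b i : EuclideanSpace ℂ G) :=
    b.orthonormal.comp_linearIsometry V.subtypeₗᵢ
  have hLb : ∀ i, ‖L (b i)‖ ^ 2 = μ := by
    intro i
    rw [← hAinner, (hmemV _).mp (b i).2, inner_smul_left, Complex.conj_ofReal,
      inner_self_eq_norm_sq_to_K, hon.1 i]
    simp
  set r : G → EuclideanSpace ℂ G := fun x ↦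
    WithLp.toLp 2 fun y ↦ starRingEnd ℂ (f (x * y⁻¹)) with hr
  have hLr : ∀ v x, ‖L v x‖ = ‖inner ℂ v (r x)‖ := by
    intro v x
    rw [hL, convLin_apply, conv_apply, ← RCLike.norm_conj, PiLp.inner_apply]
    simp [hr, map_sum]
  have hrn : ∀ x, ‖r x‖ ^ 2 = ∑ y, ‖f y‖ ^ 2 := by
    intro x
    rw [EuclideanSpace.norm_sq_eq]
    refine Fintype.sum_equiv ((Equiv.inv G).trans (Equiv.mulLeft x)) _ _ fun y ↦ ?_
    simp [hr]
  have hHS : (Module.finrank ℂ V : ℝ) * μ ≤ Fintype.card G * ∑ x, ‖f x‖ ^ 2 := by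
    calc (Module.finrank ℂ V : ℝ) * μ = ∑ i, ‖L (b i)‖ ^ 2 := by simp [hLb]
      _ = ∑ x, ∑ i, ‖inner ℂ (b i : EuclideanSpace ℂ G) (r x)‖ ^ 2 := by
        rw [Finset.sum_comm]
        refine Finset.sum_congr rfl fun i _ ↦ ?_
        rw [EuclideanSpace.norm_sq_eq]
        simp only [hLr]
      _ ≤ ∑ x, ‖r x‖ ^ 2 := Finset.sum_le_sum fun x _ ↦ hon.sum_inner_products_le _
      _ = _ := by simp [hrn]
  rw [div_mul_eq_mul_div, le_div_iff₀ hD, mul_comm]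
  exact (mul_le_mul_of_nonneg_right hdim hμ0.le).trans hHS

end Convolution

section Norms

variable {G : Type*} [Fintype G]

theorem l2norm_nonneg (ζ : G → ℂ) : 0 ≤ l2norm ζ := Real.sqrt_nonneg _

theorem l2norm_sq (ζ : G → ℂ) : l2norm ζ ^ 2 = ∑ x, ‖ζ x‖ ^ 2 :=
  Real.sq_sqrt (Finset.sum_nonneg fun _ _ ↦ by positivity)

theorem card_mul_Eavg [Nonempty G] (ζ : G → ℂ) : Fintype.card G * Eavg ζ = ∑ x, ζ x := by
  rw [Eavg, mul_div_cancel₀]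
  exact_mod_cast Fintype.card_ne_zero

theorem sum_sub_Eavg [Nonempty G] (ζ : G → ℂ) : ∑ x, (ζ x - Eavg ζ) = 0 := by
  rw [Finset.sum_sub_distrib, Finset.sum_const, Finset.card_univ, nsmul_eq_mul, card_mul_Eavg,
    sub_self]

/-- Subtracting the mean does not increase the `ℓ²`-norm. -/
theorem sum_norm_sub_Eavg_sq_le [Nonempty G] (ζ : G → ℂ) :
    ∑ x, ‖ζ x - Eavg ζ‖ ^ 2 ≤ ∑ x, ‖ζ x‖ ^ 2 := by
  set e := Eavg ζ with he
  have hx : ∀ x, ‖ζ x‖ ^ 2 =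
      ‖ζ x - e‖ ^ 2 + ‖e‖ ^ 2 + 2 * ((ζ x - e) * starRingEnd ℂ e).re := fun x ↦ by
    conv_lhs => rw [← sub_add_cancel (ζ x) e]
    simp only [← Complex.normSq_eq_norm_sq]
    exact Complex.normSq_add _ _
  have h0 : ∑ x, 2 * ((ζ x - e) * starRingEnd ℂ e).re = 0 := by
    rw [← Finset.mul_sum, ← Complex.re_sum, ← Finset.sum_mul, sum_sub_Eavg]
    simp
  rw [Finset.sum_congr rfl fun x _ ↦ hx x, Finset.sum_add_distrib, h0, add_zero]
  exact Finset.sum_le_sum fun x _ ↦ le_add_of_nonneg_right (by positivity)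

/-- Composition with a surjective homomorphism multiplies sums by the size of the kernel. -/
theorem MonoidHom.card_mul_sum_comp {G H : Type*} [Group G] [Group H] [Fintype G] [Fintype H]
    (π : G →* H) (hπ : Function.Surjective π) (F : H → ℝ) :
    Fintype.card H * ∑ b, F (π b) = Fintype.card G * ∑ y, F y := by
  classical
  set k := (Finset.univ.filter fun b ↦ π b = 1).card with hk
  have hfib : ∀ y, (Finset.univ.filter fun b ↦ π b = y).card = k := fun y ↦
    MonoidHom.card_fiber_eq_of_mem_range π (hπ y) (hπ 1)
  have hsum : ∀ F : H → ℝ, ∑ b, F (π b) = k * ∑ y, F y := by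
    intro F
    rw [← Finset.sum_fiberwise Finset.univ π, Finset.mul_sum]
    refine Finset.sum_congr rfl fun y _ ↦ ?_
    rw [Finset.sum_congr rfl fun b hb ↦ congrArg F (Finset.mem_filter.mp hb).2,
      Finset.sum_const, hfib, nsmul_eq_mul]
  have hcard := hsum fun _ ↦ 1
  simp only [Finset.sum_const, Finset.card_univ, nsmul_eq_mul, mul_one] at hcard
  rw [hsum, hcard]
  ring

end Norms

/-- A nonzero space of functions of mean zero on `SL_d(ℤ/nℤ)`, stable under right translation, has
dimension at least `(p - 1) / 2`, where `p` is the smallest prime factor of `n`. -/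
theorem minFac_sub_one_le_finrank_of_translation_invariant {d n : ℕ} [NeZero n]
    (V : Submodule ℂ (EuclideanSpace ℂ (SLmod d n))) (hV : V ≠ ⊥)
    (hinv : ∀ g, V ≤ V.comap (rightTranslation (SLmod d n) g)) (hsum : ∀ v ∈ V, ∑ x, v x = 0) :
    n.minFac - 1 ≤ 2 * Module.finrank ℂ V := by
  refine minFac_sub_one_le_finrank ((rightTranslation (SLmod d n)).subrepresentation V hinv) ?_
  by_contra! htriv
  obtain ⟨v, hvV, hv0⟩ := V.ne_bot_iff.mp hV
  have hconst : ∀ x, v x = v 1 := fun x ↦ by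
    have h1 := congrArg Subtype.val (LinearMap.congr_fun (htriv x) ⟨v, hvV⟩)
    have h2 := congrArg (fun w : EuclideanSpace ℂ (SLmod d n) ↦ w 1) h1
    have h3 : v (1 * x) = v 1 := h2
    rwa [one_mul] at h3
  have h := hsum v hvV
  rw [Finset.sum_congr rfl fun x _ ↦ hconst x, Finset.sum_const, Finset.card_univ,
    nsmul_eq_mul] at h
  have h1 : v 1 = 0 := (mul_eq_zero.mp h).resolve_left (by exact_mod_cast Fintype.card_ne_zero)
  exact hv0 (by ext x; rw [hconst, h1]; rfl)

/-- Bound for the convolution with a function of mean zero on `SL_d(ℤ/nℤ)`. -/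
theorem sum_norm_conv_sq_le {d n : ℕ} [NeZero n] (hn : 2 ≤ n) (f η : SLmod d n → ℂ)
    (hf : ∑ x, f x = 0) :
    ∑ x, ‖conv f η x‖ ^ 2 ≤ Fintype.card (SLmod d n) * (2 / ((n.minFac : ℝ) - 1)) *
      (∑ x, ‖f x‖ ^ 2) * ∑ x, ‖η x‖ ^ 2 := by
  have hp : 2 ≤ n.minFac := (Nat.minFac_prime (by omega)).two_le
  have hp' : (2 : ℝ) ≤ n.minFac := by exact_mod_cast hp
  have h := norm_convLin_sq_le (G := SLmod d n) (D := ((n.minFac : ℝ) - 1) / 2) (by linarith)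
    (fun V hV hinv hsum ↦ by
      have h1 := minFac_sub_one_le_finrank_of_translation_invariant V hV hinv hsum
      have h2 : (n.minFac : ℝ) ≤ 2 * Module.finrank ℂ V + 1 := by
        exact_mod_cast (by omega : n.minFac ≤ 2 * Module.finrank ℂ V + 1)
      linarith) f hf (WithLp.toLp 2 η)
  rw [EuclideanSpace.norm_sq_eq, EuclideanSpace.norm_sq_eq] at h
  simp only [convLin_apply] at h
  rw [div_div_eq_mul_div] at h
  rwa [← mul_div_assoc]

/-- Subtracting the main term amounts to replacing `ζ` by `ζ - E ζ`. -/
theorem circConv_conv_sub {Gn Gm : Type*} [Group Gn] [Group Gm] [Fintype Gn] [Fintype Gm]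
    (π : Gm → Gn) (ζ η : Gn → ℂ) (ξ : Gm → ℂ) (x : Gn) :
    circConv π (conv ζ η) ξ x -
        Eavg ζ * Eavg η * Eavg ξ * Fintype.card Gn * Fintype.card Gm =
      circConv π (conv (fun y ↦ ζ y - Eavg ζ) η) ξ x := by
  have h : ∀ z, conv (fun y ↦ ζ y - Eavg ζ) η z = conv ζ η z - Eavg ζ * ∑ y, η y := by
    intro z
    simp only [conv_apply, sub_mul, Finset.sum_sub_distrib, ← Finset.mul_sum]
  simp only [circConv, h, sub_mul, Finset.sum_sub_distrib, ← Finset.mul_sum]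
  rw [← card_mul_Eavg η, ← card_mul_Eavg ξ]
  ring

/-- Claim 5.7: for `d ≥ 2`, `n ∣ m`, `p` the smallest prime divisor of `n`, and all
`ζ, η : G_n → ℂ`, `ξ : G_m → ℂ`:
`‖(ζ ∗ η) ⊛ ξ − (Eζ)(Eη)(Eξ)|G_n||G_m|‖_∞ ≤ √(2|G_m|/(p−1)) ‖ζ‖₂ ‖η‖₂ ‖ξ‖₂`. -/
theorem triple_convolution_bound (d n m : ℕ) (hd : 2 ≤ d) (hn : 2 ≤ n) (hm : 2 ≤ m)
    (hdvd : n ∣ m) [NeZero n] [NeZero m]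
    (ζ η : SLmod d n → ℂ) (ξ : SLmod d m → ℂ) (x : SLmod d n) :
    ‖circConv (redMod d hdvd) (conv ζ η) ξ x -
        Eavg ζ * Eavg η * Eavg ξ * (Nat.card (SLmod d n) : ℂ) *
          (Nat.card (SLmod d m) : ℂ)‖ ≤
      Real.sqrt (2 * (Nat.card (SLmod d m)) / ((n.minFac : ℝ) - 1)) *
        l2norm ζ * l2norm η * l2norm ξ := by
  set p : ℝ := (n.minFac : ℝ) - 1 with hp
  have hp0 : 0 < p := by
    have : (2 : ℝ) ≤ n.minFac := by exact_mod_cast (Nat.minFac_prime (by omega)).two_le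
    linarith
  simp only [Nat.card_eq_fintype_card]
  rw [circConv_conv_sub]
  set f : SLmod d n → ℂ := fun y ↦ ζ y - Eavg ζ with hf
  set S := ∑ b, ‖conv f η (x * (redMod d hdvd b)⁻¹)‖ ^ 2 with hS
  have hcn : (0 : ℝ) < Fintype.card (SLmod d n) := by exact_mod_cast Fintype.card_pos
  have hconv : ∑ y, ‖conv f η y‖ ^ 2 ≤
      Fintype.card (SLmod d n) * (2 / p) * l2norm ζ ^ 2 * l2norm η ^ 2 := by
    rw [l2norm_sq, l2norm_sq]
    refine (sum_norm_conv_sq_le hn f η (sum_sub_Eavg ζ)).trans ?_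
    have := sum_norm_sub_Eavg_sq_le ζ
    exact mul_le_mul_of_nonneg_right (mul_le_mul_of_nonneg_left this (by positivity))
      (by positivity)
  have hSle : S ≤ 2 * Fintype.card (SLmod d m) / p * (l2norm ζ * l2norm η) ^ 2 := by
    have h1 := (redMod d hdvd).card_mul_sum_comp (redMod_surjective d hdvd)
      fun y ↦ ‖conv f η (x * y⁻¹)‖ ^ 2
    have h2 : ∑ y, ‖conv f η (x * y⁻¹)‖ ^ 2 = ∑ y, ‖conv f η y‖ ^ 2 :=
      Fintype.sum_equiv ((Equiv.inv _).trans (Equiv.mulLeft x)) _ _ fun _ ↦ rfl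
    rw [h2] at h1
    refine le_of_mul_le_mul_left ?_ hcn
    calc Fintype.card (SLmod d n) * S = _ := h1
      _ ≤ Fintype.card (SLmod d m) *
          (Fintype.card (SLmod d n) * (2 / p) * l2norm ζ ^ 2 * l2norm η ^ 2) := by gcongr
      _ = _ := by ring
  calc ‖circConv (redMod d hdvd) (conv f η) ξ x‖
      ≤ ∑ b, ‖conv f η (x * (redMod d hdvd b)⁻¹)‖ * ‖ξ b‖ := by
        refine (norm_sum_le _ _).trans_eq ?_
        simp only [norm_mul]
    _ ≤ Real.sqrt S * l2norm ξ := Real.sum_mul_le_sqrt_mul_sqrt _ _ _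
    _ ≤ Real.sqrt (2 * Fintype.card (SLmod d m) / p * (l2norm ζ * l2norm η) ^ 2) * l2norm ξ := by
        gcongr
        exact l2norm_nonneg ξ
    _ = _ := by
        rw [Real.sqrt_mul (by positivity),
          Real.sqrt_sq (mul_nonneg (l2norm_nonneg ζ) (l2norm_nonneg η)), ← mul_assoc]
end
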